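/- There is a constant C > 0 such that for every natural number N ≥ 2 there exists a finite tile set T_N whose glue strengths all lie in {−s, 0, 1} with exactly one glue color of negative strength, such that for every integer s ≥ 1 the partially glue restricted system 𝒯 = (T_N, σ, 1) obtained by giving the unique negative glue color strength −s is directed, the N×N square S_N strictly self-assembles in 𝒯, and |T_N| ≤ C · log₂ N. -/

import Mathlib

namespace TA

abbrev Pos : Type := ℤ × ℤ

def U2 : Finset Pos := {(0, 1), (1, 0), (0, -1), (-1, 0)}

structure Tile where
  col : Pos → ℕ
  str : Pos → ℤ

noncomputable instance : DecidableEq Tile := Classical.decEq _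

/-- Interaction strength between side `u` of tile `t` and side `-u` of tile `t'`
(diagonal glue function: glues interact only if both color and strength match). -/
def interaction (t t' : Tile) (u : Pos) : ℤ :=
  if t.col u = t'.col (-u) ∧ t.str u = t'.str (-u) then t.str u else 0

abbrev Assembly : Type := Pos → Option Tile

def adom (α : Assembly) : Set Pos := {x | α x ≠ none}

/-- Total binding strength experienced by tile `t` when placed at position `m` in `α`. -/
def bindStrength (α : Assembly) (t : Tile) (m : Pos) : ℤ :=
  ∑ u ∈ U2, (α (m + u)).elim 0 (fun t' => interaction t t' u)

/-- A tile assembly system: a finite tile set, a single seed tile (placed at the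
origin), and a temperature. -/
structure TAS where
  tiles : Finset Tile
  seedTile : Tile
  temp : ℤ
  seed_mem : seedTile ∈ tiles

def TAS.seed (𝒯 : TAS) : Assembly := fun x => if x = (0, 0) then some 𝒯.seedTile else none

/-- Tile `t` may be placed at empty position `m` of `α` if the sum of its
interaction strengths with adjacent tiles is at least the temperature
(irreversible model: negative glues count toward the sum). -/
def CanPlace (𝒯 : TAS) (α : Assembly) (m : Pos) (t : Tile) : Prop :=
  t ∈ 𝒯.tiles ∧ α m = none ∧ 𝒯.temp ≤ bindStrength α t m

def Step (𝒯 : TAS) (α β : Assembly) : Prop :=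
  ∃ m t, CanPlace 𝒯 α m t ∧ β = Function.update α m (some t)

/-- A (possibly stuttering) assembly sequence starting at the seed. -/
def AsmSeq (𝒯 : TAS) (f : ℕ → Assembly) : Prop :=
  f 0 = 𝒯.seed ∧ ∀ i, Step 𝒯 (f i) (f (i + 1)) ∨ f (i + 1) = f i

/-- `α` is the result (union) of the assembly sequence `f`. -/
def IsResult (f : ℕ → Assembly) (α : Assembly) : Prop :=
  ∀ x, (∃ i, f i x = α x ∧ f i x ≠ none) ∨ (α x = none ∧ ∀ i, f i x = none)

def Producible (𝒯 : TAS) (α : Assembly) : Prop :=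
  ∃ f, AsmSeq 𝒯 f ∧ IsResult f α

/-- No tile can be added to `α`. -/
def Stuck (𝒯 : TAS) (α : Assembly) : Prop := ∀ m t, ¬ CanPlace 𝒯 α m t

def Terminal (𝒯 : TAS) (α : Assembly) : Prop := Producible 𝒯 α ∧ Stuck 𝒯 α

/-- A TAS is directed if it has exactly one terminal assembly. -/
def DirectedTAS (𝒯 : TAS) : Prop := ∃! α, Terminal 𝒯 α

/-- `X` strictly self-assembles in `𝒯`: the domain of every terminal assembly is a
translate of `X`. -/
def StrictlySelfAssembles (𝒯 : TAS) (X : Set Pos) : Prop :=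
  ∀ α, Terminal 𝒯 α → ∃ v : Pos, adom α = (fun p => p + v) '' X

/-- Every glue strength lies in {-1,0,1}, and there is exactly one glue color of
strength `-1`. -/
def GlueRestricted (T : Finset Tile) : Prop :=
  (∀ t ∈ T, ∀ u ∈ U2, t.str u ∈ ({-1, 0, 1} : Set ℤ)) ∧
  (∃! c : ℕ, ∃ t ∈ T, ∃ u ∈ U2, t.col u = c ∧ t.str u = -1)

/-- A glue-restricted temperature-1 TAS. -/
def IsRgTAS (𝒯 : TAS) : Prop := GlueRestricted 𝒯.tiles ∧ 𝒯.temp = 1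

/-- The `N × N` square `{0,…,N-1} × {0,…,N-1}`. -/
def SN (N : ℕ) : Set Pos := {p : Pos | 0 ≤ p.1 ∧ p.1 < (N : ℤ) ∧ 0 ≤ p.2 ∧ p.2 < (N : ℤ)}

/-- Give every negative-strength glue of `t` strength `-s` instead. -/
def reStr (s : ℤ) (t : Tile) : Tile := ⟨t.col, fun u => if t.str u < 0 then -s else t.str u⟩

/-- A complete run: steps happen as long as possible, and once stuck the sequence
stutters.  A TAS "admits exactly one assembly sequence" iff `∃! f, RunSeq 𝒯 f`. -/
def RunSeq (𝒯 : TAS) (f : ℕ → Assembly) : Prop :=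
  f 0 = 𝒯.seed ∧ ∀ i, Step 𝒯 (f i) (f (i + 1)) ∨ (Stuck 𝒯 (f i) ∧ f (i + 1) = f i)

/-- `u` is an input side of position `x` in the assembly sequence `f`. -/
def InSide (f : ℕ → Assembly) (x u : Pos) : Prop :=
  ∃ i t t', f i x = none ∧ f (i + 1) x = some t ∧ f i (x + u) = some t' ∧
    0 < interaction t t' u

/-- A zig-zag TAS: temperature 2, directed, unique assembly sequence, and no tile
ever has `(0,1)` as an input side. -/
def ZigZag (𝒯 : TAS) : Prop :=
  𝒯.temp = 2 ∧ DirectedTAS 𝒯 ∧ (∃! f, RunSeq 𝒯 f) ∧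
    ∀ f, RunSeq 𝒯 f → ∀ x, ¬ InSide f x (0, 1)

def CompactZigZag (𝒯 : TAS) : Prop :=
  ZigZag 𝒯 ∧ ∀ α, Terminal 𝒯 α → ∀ x t, α x = some t → ∀ u ∈ U2, t.str u + t.str (-u) < 4

/-- `𝒮` path simulates `𝒯` at scale factor `c`: `𝒮` has a unique assembly
sequence, and there are segment indices `I` (with `c` the maximal segment length,
attained) and a map `F` from producible assemblies of `𝒮` to producible assemblies
of `𝒯` sending the result of the `j`-th segment of `𝒮`'s run to the `j`-th assembly
of `𝒯`'s run. -/
def PathSimulates (𝒮 𝒯 : TAS) (c : ℕ) : Prop :=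
  (∃! g, RunSeq 𝒮 g) ∧
  ∀ f g, RunSeq 𝒯 f → RunSeq 𝒮 g →
    ∃ I : ℕ → ℕ, I 0 = 0 ∧ StrictMono I ∧
      (∀ j, I (j + 1) - I j ≤ c) ∧ (∃ j, I (j + 1) - I j = c) ∧
      ∃ F : Assembly → Assembly,
        (∀ β, Producible 𝒮 β → Producible 𝒯 (F β)) ∧
        ∀ j, F (g (I (j + 1) - 1)) = f j

end TA

namespace TA

def UStep (𝒯 : TAS) (α β : Assembly) : Prop :=
  (∃ m t, CanPlace 𝒯 α m t) ∧
    ∀ m t, CanPlace 𝒯 α m t → Function.update α m (some t) = β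

def Extends (α β : Assembly) : Prop := ∀ x, α x ≠ none → β x = α x

theorem Extends.refl (α : Assembly) : Extends α α := fun _ _ => rfl

theorem Extends.trans {α β γ : Assembly} (h : Extends α β) (h' : Extends β γ) :
    Extends α γ := fun x hx => by
  rw [h' x (by rw [h x hx]; exact hx), h x hx]

theorem extends_update {α : Assembly} {m : Pos} (t : Tile) (hm : α m = none) :
    Extends α (Function.update α m (some t)) := fun x hx => by
  have : x ≠ m := by rintro rfl; exact hx hm
  simp [Function.update_of_ne this]

theorem UStep.extends {𝒯 : TAS} {α β : Assembly} (h : UStep 𝒯 α β) : Extends α β := by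
  obtain ⟨⟨m, t, hm⟩, h2⟩ := h
  rw [← h2 m t hm]
  exact extends_update t hm.2.1

theorem extends_of_run {𝒯 : TAS} {α β : Assembly}
    (h : Relation.ReflTransGen (UStep 𝒯) α β) : Extends α β := by
  induction h with
  | refl => exact Extends.refl _
  | tail _ h ih => exact ih.trans h.extends

theorem AsmSeq.extends {𝒯 : TAS} {f : ℕ → Assembly} (hf : AsmSeq 𝒯 f) {i j : ℕ} (hij : i ≤ j) :
    Extends (f i) (f j) := by
  induction hij with
  | refl => exact Extends.refl _
  | step _ ih =>
    refine ih.trans ?_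
    rcases hf.2 _ with ⟨m, t, h, h'⟩ | h
    · rw [h']; exact extends_update t h.2.1
    · rw [h]; exact Extends.refl _

/-- An inductive invariant whose only stuck assembly is `A` shows that `A` is the unique
terminal assembly. -/
theorem terminal_iff_of_invariant (𝒯 : TAS) (Good : Assembly → Prop) (A : Assembly)
    (hfin : (adom A).Finite) (hseed : Good 𝒯.seed)
    (hsub : ∀ α, Good α → Extends α A)
    (hstep : ∀ α m t, Good α → CanPlace 𝒯 α m t → Good (Function.update α m (some t)))
    (hprog : ∀ α, Good α → Stuck 𝒯 α → α = A) (α : Assembly) :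
    Terminal 𝒯 α ↔ α = A := by
  classical
  constructor
  · rintro ⟨⟨f, hf, hr⟩, hst⟩
    have hgood : ∀ i, Good (f i) := by
      intro i
      induction i with
      | zero => rw [hf.1]; exact hseed
      | succ i ih =>
        rcases hf.2 i with ⟨m, t, h, h'⟩ | h
        · rw [h']; exact hstep _ _ _ ih h
        · rw [h]; exact ih
    have key : ∀ x, ∃ i, f i x = α x := by
      intro x
      rcases hr x with ⟨i, h, -⟩ | ⟨h, h'⟩
      · exact ⟨i, h⟩
      · exact ⟨0, by rw [h, h']⟩
    choose g hg using key
    have : ∃ n, ∀ x ∈ adom A, g x ≤ n := by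
      refine ⟨hfin.toFinset.sup g, fun x hx => Finset.le_sup (f := g) (by simpa using hx)⟩
    obtain ⟨n, hn⟩ := this
    have hα : α = f n := by
      funext x
      rcases hr x with ⟨i, h, h0⟩ | ⟨h, h'⟩
      · have hx : x ∈ adom A := by
          simp only [adom, Set.mem_ofPred_eq]
          rw [hsub _ (hgood i) x h0]; exact h0
        have h1 := hf.extends (hn x hx) x (by rw [hg, ← h]; exact h0)
        rw [h1, hg]
      · rw [h, h']
    rw [hα] at hst ⊢
    exact hprog _ (hgood n) hst
  · rintro rfl
    have main : ∀ n : ℕ, ∀ β : Assembly, Good β → (adom α \ adom β).ncard = n →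
        ∃ f : ℕ → Assembly, f 0 = β ∧ (∀ i, Step 𝒯 (f i) (f (i + 1)) ∨ f (i + 1) = f i) ∧
          ∃ k, f k = α ∧ ∀ i, k ≤ i → f i = α := by
      intro n
      induction n using Nat.strong_induction_on with
      | _ n ih =>
        intro β hβ hn
        by_cases hs : Stuck 𝒯 β
        · have := hprog β hβ hs
          exact ⟨fun _ => β, rfl, fun i => Or.inr rfl, 0, this, fun _ _ => this⟩
        · simp only [Stuck, not_forall, not_not] at hs
          obtain ⟨m, t, hmt⟩ := hs
          have hg := hstep _ _ _ hβ hmt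
          have hm : m ∈ adom α := by
            have := hsub _ hg m (by simp)
            simp only [adom, Set.mem_ofPred_eq, this]; simp
          have hlt : (adom α \ adom (Function.update β m (some t))).ncard < n := by
            rw [← hn]
            refine Set.ncard_lt_ncard ?_ (hfin.subset Set.sdiff_subset)
            refine ⟨fun x hx => ⟨hx.1, fun hx' => hx.2 ?_⟩, fun hh => ?_⟩
            · have hx'' : β x ≠ none := hx'
              have := extends_update t hmt.2.1 x hx''
              simp only [adom, Set.mem_ofPred_eq, this]; exact hx''
            · have := (hh ⟨hm, fun h => h hmt.2.1⟩).2
              apply this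
              simp [adom]
          obtain ⟨f, h0, h1, k, hk, hk'⟩ := ih _ hlt _ hg rfl
          refine ⟨fun i => Nat.casesOn i β f, rfl, ?_, k + 1, hk, ?_⟩
          · intro i
            cases i with
            | zero => exact Or.inl ⟨m, t, hmt, h0⟩
            | succ i => exact h1 i
          · intro i hi
            cases i with
            | zero => omega
            | succ i => exact hk' i (by omega)
    obtain ⟨f, h0, h1, k, hk, hk'⟩ := main _ 𝒯.seed hseed rfl
    have hf : AsmSeq 𝒯 f := ⟨h0, h1⟩
    have hgood : ∀ i, Good (f i) := by
      intro i
      induction i with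
      | zero => rw [hf.1]; exact hseed
      | succ i ih =>
        rcases hf.2 i with ⟨m, t, h, h'⟩ | h
        · rw [h']; exact hstep _ _ _ ih h
        · rw [h]; exact ih
    refine ⟨⟨f, hf, fun x => ?_⟩, ?_⟩
    · by_cases hx : α x = none
      · refine Or.inr ⟨hx, fun i => ?_⟩
        by_contra hne
        have := hsub _ (hgood i) x hne
        rw [hx] at this
        exact hne this.symm
      · exact Or.inl ⟨k, by rw [hk], by rw [hk]; exact hx⟩
    · intro m t hmt
      have := hk ▸ hgood k
      have h2 := hsub _ (hstep _ _ _ this hmt) m (by simp)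
      rw [hmt.2.1] at h2
      simp at h2

theorem mem_U2 {u : Pos} : u ∈ U2 ↔ u = (0, 1) ∨ u = (1, 0) ∨ u = (0, -1) ∨ u = (-1, 0) := by
  simp [U2]

theorem neg_mem_U2 {u : Pos} (h : u ∈ U2) : -u ∈ U2 := by
  rcases mem_U2.1 h with rfl | rfl | rfl | rfl <;> decide

theorem ne_neg_of_mem_U2 {u : Pos} (h : u ∈ U2) : u ≠ -u := by
  rcases mem_U2.1 h with rfl | rfl | rfl | rfl <;> decide

/-- The only positive glue exposed by `α` towards empty positions sits at `p - d`, points in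
direction `d`, and has color `c`. -/
structure Tip (α : Assembly) (p d : Pos) (c : ℕ) : Prop where
  mem : d ∈ U2
  empty : α p = none
  only : ∀ m u t', u ∈ U2 → α m = none → α (m + u) = some t' → 0 < t'.str (-u) →
    m = p ∧ u = -d ∧ t'.col (-u) = c
  tip : ∃ t', α (p - d) = some t' ∧ t'.str d = 1 ∧ t'.col d = c

def term (α : Assembly) (t : Tile) (m u : Pos) : ℤ :=
  (α (m + u)).elim 0 (fun t' => interaction t t' u)

theorem exists_pos_of_bind {α : Assembly} {t : Tile} {m : Pos} (h : 1 ≤ bindStrength α t m) :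
    ∃ u ∈ U2, ∃ t', α (m + u) = some t' ∧ 0 < interaction t t' u := by
  by_contra hcon
  push Not at hcon
  have : bindStrength α t m ≤ 0 := by
    refine Finset.sum_nonpos fun u hu => ?_
    rcases hq : α (m + u) with _ | t'
    · simp
    · simpa using hcon u hu t' hq
  omega

theorem pos_interaction {t t' : Tile} {u : Pos} (h : 0 < interaction t t' u) :
    t.col u = t'.col (-u) ∧ t.str u = t'.str (-u) ∧ 0 < t.str u := by
  unfold interaction at h
  split_ifs at h with hc
  · exact ⟨hc.1, hc.2, h⟩
  · omega

theorem interaction_nonneg {t t' : Tile} {u : Pos} (h : 0 ≤ t.str u ∨ 0 ≤ t'.str (-u)) :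
    0 ≤ interaction t t' u := by
  unfold interaction
  split_ifs with hc
  · rcases h with h | h
    · exact h
    · rw [hc.2]; exact h
  · exact le_rfl

theorem one_le_bind {α : Assembly} {t : Tile} {m d : Pos} (hd : d ∈ U2)
    (h1 : 1 ≤ term α t m d)
    (h2 : ∀ u ∈ U2, u ≠ d → 0 ≤ term α t m u) : 1 ≤ bindStrength α t m := by
  classical
  have : bindStrength α t m = term α t m d + ∑ u ∈ U2.erase d, term α t m u :=
    (Finset.add_sum_erase _ _ hd).symm
  rw [this]
  have := Finset.sum_nonneg (s := U2.erase d) (f := fun u => term α t m u)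
    (fun u hu => h2 u (Finset.mem_of_mem_erase hu) (Finset.ne_of_mem_erase hu))
  omega

theorem bind_le_zero {α : Assembly} {t : Tile} {m d v : Pos} (hd : d ∈ U2) (hv : v ∈ U2)
    (hdv : v ≠ d) (h1 : term α t m d ≤ 1) (h2 : term α t m v ≤ -1)
    (h3 : ∀ u ∈ U2, u ≠ d → term α t m u ≤ 0) : bindStrength α t m ≤ 0 := by
  classical
  have e1 : bindStrength α t m = term α t m d + ∑ u ∈ U2.erase d, term α t m u :=
    (Finset.add_sum_erase _ _ hd).symm
  have hv' : v ∈ U2.erase d := Finset.mem_erase.2 ⟨hdv, hv⟩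
  have e2 : ∑ u ∈ U2.erase d, term α t m u =
      term α t m v + ∑ u ∈ (U2.erase d).erase v, term α t m u :=
    (Finset.add_sum_erase _ _ hv').symm
  have := Finset.sum_nonpos (s := (U2.erase d).erase v) (f := fun u => term α t m u)
    (fun u hu => by
      have := Finset.mem_of_mem_erase hu
      exact h3 u (Finset.mem_of_mem_erase this) (Finset.ne_of_mem_erase this))
  omega

/-- Extending an assembly with a single exposed tip by the only tile that fits there. -/
theorem Tip.step {𝒯 : TAS} (hτ : 𝒯.temp = 1) {α : Assembly} {p d : Pos} {c : ℕ}
    (h : Tip α p d c) {t : Tile} (ht : t ∈ 𝒯.tiles) (htc : t.col (-d) = c) (hts : t.str (-d) = 1)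
    (hle : ∀ t ∈ 𝒯.tiles, ∀ u, t.str u ≤ 1)
    (hright : ∀ u ∈ U2, u ≠ -d → ∀ t', α (p + u) = some t' → 0 ≤ t.str u ∨ 0 ≤ t'.str (-u))
    (hwrong : ∀ t₂ ∈ 𝒯.tiles, t₂ ≠ t → t₂.col (-d) = c → t₂.str (-d) = 1 →
      ∃ u ∈ U2, u ≠ -d ∧ ∃ t', α (p + u) = some t' ∧ interaction t₂ t' u ≤ -1)
    {d' : Pos} {c' : ℕ} (hd' : d' ∈ U2) (htc' : t.col d' = c') (hts' : t.str d' = 1)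
    (hout : ∀ u ∈ U2, 0 < t.str u → u = -d ∨ u = d')
    (hfree : α (p + d') = none) :
    UStep 𝒯 α (Function.update α p (some t)) ∧
      Tip (Function.update α p (some t)) (p + d') d' c' := by
  obtain ⟨t0, h0, h0s, h0c⟩ := h.tip
  have hnd := neg_mem_U2 h.mem
  have hterm : ∀ t₂ : Tile, ∀ u ∈ U2, u ≠ -d → term α t₂ p u ≤ 0 := by
    intro t₂ u hu hne
    unfold term
    rcases hq : α (p + u) with _ | t'
    · simp
    · by_contra hcon
      have := pos_interaction (not_le.1 hcon)
      exact hne (h.only p u t' hu h.empty hq (by rw [← this.2.1]; exact this.2.2)).2.1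
  have hcan : CanPlace 𝒯 α p t := by
    refine ⟨ht, h.empty, ?_⟩
    rw [hτ]
    refine one_le_bind hnd ?_ ?_
    · have : p + -d = p - d := by abel
      simp [term, this, h0, interaction, htc, hts, h0s, h0c]
    · intro u hu hne
      unfold term
      rcases hq : α (p + u) with _ | t'
      · simp
      · exact interaction_nonneg (hright u hu hne t' hq)
  have huniq : ∀ m t₂, CanPlace 𝒯 α m t₂ → m = p ∧ t₂ = t := by
    rintro m t₂ ⟨hm1, hm2, hm3⟩
    rw [hτ] at hm3
    obtain ⟨u, hu, t', hq, hpos⟩ := exists_pos_of_bind hm3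
    have hi := pos_interaction hpos
    obtain ⟨rfl, rfl, hc⟩ := h.only m u t' hu hm2 hq (by rw [← hi.2.1]; exact hi.2.2)
    refine ⟨rfl, ?_⟩
    by_contra hne
    have hs1 : t₂.str (-d) = 1 := by
      have := hle t₂ hm1 (-d)
      have := hi.2.2
      omega
    obtain ⟨v, hv, hvd, t'', hq', hneg⟩ := hwrong t₂ hm1 hne (by rw [hi.1, hc]) hs1
    have : bindStrength α t₂ m ≤ 0 := by
      refine bind_le_zero hnd hv hvd ?_ ?_ (hterm t₂)
      · simp only [term, hq, Option.elim_some]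
        unfold interaction
        split_ifs <;> omega
      · simpa only [term, hq', Option.elim_some] using hneg
    omega
  refine ⟨⟨⟨p, t, hcan⟩, fun m t₂ hm => ?_⟩, ?_⟩
  · obtain ⟨rfl, rfl⟩ := huniq m t₂ hm
    rfl
  · have hd0 : d' ≠ 0 := by
      rintro rfl
      rw [add_zero] at hfree
      revert hd'; decide
    have hpd : p + d' ≠ p := by simpa using hd0
    refine ⟨hd', ?_, ?_, ?_⟩
    · rw [Function.update_of_ne hpd, hfree]
    · intro m u t' hu hm hq hs
      have hmp : m ≠ p := by rintro rfl; simp at hm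
      rw [Function.update_of_ne hmp] at hm
      by_cases hmu : m + u = p
      · rw [hmu, Function.update_self] at hq
        obtain rfl := Option.some.inj hq
        rcases hout (-u) (neg_mem_U2 hu) hs with h1 | h1
        · have : m = p - d := by rw [← hmu, ← neg_inj.1 h1]; abel
          rw [this, h0] at hm
          simp at hm
        · refine ⟨by rw [← h1, ← hmu]; abel, by rw [← h1, neg_neg], by rw [h1, htc']⟩
      · rw [Function.update_of_ne hmu] at hq
        exact absurd (h.only m u t' hu hm hq hs).1 hmp
    · refine ⟨t, ?_, hts', htc'⟩
      rw [add_sub_cancel_right, Function.update_self]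

/-- A tile with positive glues `g` and at most one negative glue, of color `0` and strength
`-s`, on the side `neg`. -/
def mkTile (s : ℤ) (g : Pos → Option ℕ) (neg : Option Pos) : Tile where
  col u := if neg = some u then 0 else (g u).getD 0
  str u := if neg = some u then -s else if (g u).isSome then 1 else 0

theorem reStr_mkTile {s : ℤ} (g : Pos → Option ℕ) (neg : Option Pos) :
    reStr s (mkTile 1 g neg) = mkTile s g neg := by
  simp only [reStr, mkTile]
  congr 1
  funext u
  split_ifs <;> simp_all

theorem mkTile_str_le {s : ℤ} (hs : 1 ≤ s) (g : Pos → Option ℕ) (neg : Option Pos) (u : Pos) :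
    (mkTile s g neg).str u ≤ 1 := by
  simp only [mkTile]
  split_ifs <;> omega

theorem mkTile_pos {s : ℤ} (hs : 1 ≤ s) {g : Pos → Option ℕ} {neg : Option Pos} {u : Pos}
    (h : 0 < (mkTile s g neg).str u) : g u = some ((mkTile s g neg).col u) := by
  simp only [mkTile] at h ⊢
  split_ifs at h ⊢ with h1 h2
  · omega
  · obtain ⟨a, ha⟩ := Option.isSome_iff_exists.1 h2
    simp [ha]
  · omega

theorem mkTile_of_ne {s : ℤ} {g : Pos → Option ℕ} {neg : Option Pos} {u : Pos} {a : ℕ}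
    (h : neg ≠ some u) (hg : g u = some a) :
    (mkTile s g neg).str u = 1 ∧ (mkTile s g neg).col u = a := by
  simp [mkTile, h, hg]

theorem mkTile_nonneg {s : ℤ} {g : Pos → Option ℕ} {neg : Option Pos} {u : Pos}
    (h : neg ≠ some u) : 0 ≤ (mkTile s g neg).str u := by
  simp only [mkTile, h, if_false]
  split_ifs <;> omega

theorem mkTile_neg {s : ℤ} {g : Pos → Option ℕ} {neg : Option Pos} {u : Pos}
    (h : neg = some u) : (mkTile s g neg).str u = -s ∧ (mkTile s g neg).col u = 0 := by
  simp [mkTile, h]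

abbrev dN : Pos := (0, 1)
abbrev dE : Pos := (1, 0)
abbrev dS : Pos := (0, -1)
abbrev dW : Pos := (-1, 0)

/-- The `j`-th clockwise quarter turn. -/
def rot : ℕ → Pos → Pos
  | 0, p => p
  | 1, p => (p.2, -p.1)
  | 2, p => (-p.1, -p.2)
  | _, p => (-p.2, p.1)

theorem rot_add (j : ℕ) (p q : Pos) : rot j (p + q) = rot j p + rot j q := by
  match j with
  | 0 => rfl
  | 1 => ext <;> simp [rot]; ring
  | 2 => ext <;> simp [rot] <;> ring
  | n + 3 => ext <;> simp [rot]; ring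

theorem rot_neg (j : ℕ) (p : Pos) : rot j (-p) = -rot j p := by
  match j with
  | 0 => rfl
  | 1 => ext <;> simp [rot]
  | 2 => ext <;> simp [rot]
  | n + 3 => ext <;> simp [rot]

theorem rot_injective (j : ℕ) : Function.Injective (rot j) := by
  rintro ⟨a, b⟩ ⟨c, d⟩ h
  match j with
  | 0 => exact h
  | 1 => simp [rot] at h; ext <;> simp [h]
  | 2 => simp [rot] at h; ext <;> simp [h]
  | n + 3 => simp [rot] at h; ext <;> simp [h]

theorem rot_mem (j : ℕ) {u : Pos} (hu : u ∈ U2) : rot j u ∈ U2 := by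
  rcases mem_U2.1 hu with rfl | rfl | rfl | rfl <;>
  · match j with
    | 0 => simp [rot, U2]
    | 1 => simp [rot, U2]
    | 2 => simp [rot, U2]
    | n + 3 => simp [rot, U2]

/-- Parameters of the frame construction: number of bits, whether strips are one column
wider, the size of the square, the number of counter cycles, and the initial bits of the
four counters. -/
structure Par where
  w : ℕ
  wide : Bool
  N : ℕ
  K : ℕ
  bits : ℕ → ℕ → Bool

/-- The width of a strip. -/
def Par.W (P : Par) : ℤ := 4 * P.w + if P.wide then 3 else 2

/-- Image of the local origin of strip `j`. -/
def Par.corner (P : Par) : ℕ → Pos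
  | 0 => (1 - P.W, 0)
  | 1 => (1 - P.W, P.N - 1)
  | 2 => (P.N - P.W, P.N - 1)
  | _ => (P.N - P.W, 0)

/-- Local coordinates of strip `j` to global coordinates. -/
def Par.emb (P : Par) (j : ℕ) (z : Pos) : Pos := rot j z + P.corner j

theorem Par.emb_add (P : Par) (j : ℕ) (z u : Pos) : P.emb j (z + u) = P.emb j z + rot j u := by
  simp only [Par.emb, rot_add]; abel

theorem Par.emb_injective (P : Par) (j : ℕ) : Function.Injective (P.emb j) := fun _ _ h =>
  rot_injective j (add_right_cancel h)

/-- Strip, kind of segment, bit position, carry, bit, and index within the segment. -/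
abbrev Label : Type := ℕ × ℕ × ℕ × Bool × Bool × ℕ

def code (l : Label) : ℕ := Encodable.encode l + 1

theorem code_injective : Function.Injective code := fun _ _ h => by
  simp only [code, Nat.add_right_cancel_iff] at h
  exact Encodable.encode_injective h

abbrev Cell : Type := Pos × Option Pos

/-- A negative glue towards `u` encoding the bit `v`. -/
def sideIf (v : Bool) (u : Pos) : Option Pos := if v then some u else none

def cell (d : Pos) : Cell := (d, none)

def segStart : Bool → List Cell
  | false => [cell dW, cell dN, cell dN, cell dW, cell dS, cell dS]
  | true => [cell dW, cell dW, cell dN, cell dE, cell dN, cell dW, cell dW, cell dS, cell dS]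

def segInit (v : Bool) : List Cell :=
  [cell dW, (dW, sideIf (!v) dN), cell dW, (dN, sideIf v dE), cell dN, cell dW, cell dS, cell dS]

def segInitLast (v : Bool) : List Cell :=
  [cell dW, (dW, sideIf (!v) dN), cell dW, cell dW, cell dN, (dE, sideIf v dE), cell dN, cell dW,
    cell dN, cell dN, cell dN, cell dE, cell dS, cell dS, cell dE, cell dS]

def readA (b : Bool) : Cell := (dS, some (if b then dS else dW))

def readB (b : Bool) : Cell := (dS, some (if b then dS else dE))

def segInc (b v : Bool) : List Cell :=
  [readA b, cell dE, cell dN, (dN, sideIf (!v) dN), cell dE, (dN, sideIf v dW), cell dN, cell dE,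
    cell dS, cell dS, cell dE, cell dS]

def segIncLast : Bool → Bool → Bool → List Cell
  | false, b, v =>
    [readA b, cell dE, cell dN, (dN, sideIf (!v) dN), cell dE, cell dE, cell dN,
      (dW, sideIf v dW), cell dN, cell dE, cell dN, cell dN, cell dN, cell dW, cell dS, cell dS,
      cell dW, cell dS]
  | true, b, v =>
    [readA b, cell dE, cell dN, (dN, sideIf (!v) dN), cell dE, cell dE, cell dE, cell dN, cell dW,
      (dW, sideIf v dW), cell dN, cell dE, cell dE, cell dN, cell dW, cell dN, cell dE, cell dN,
      cell dW, cell dW, cell dS, cell dS, cell dW, cell dS]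

def segOver : Bool → Bool → Bool → List Cell
  | false, b, v =>
    [readA b, cell dE, cell dN, (dN, sideIf (!v) dN), cell dE, cell dE, cell dN,
      (dW, sideIf v dW), cell dN, cell dE, cell dN, cell dW]
  | true, b, v =>
    [readA b, cell dE, cell dN, (dN, sideIf (!v) dN), cell dE, cell dE, cell dE, cell dN, cell dW,
      (dW, sideIf v dW), cell dN, cell dE, cell dE, cell dN, cell dW, cell dW]

def segCopy (b : Bool) : List Cell :=
  [readB b, cell dW, cell dN, (dN, sideIf (!b) dN), cell dW, (dN, sideIf b dE), cell dN, cell dW,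
    cell dS, cell dS, cell dW, cell dS]

def segCopyLast (b : Bool) : List Cell :=
  [readB b, cell dW, cell dN, (dN, sideIf (!b) dN), cell dW, cell dW, cell dN, (dE, sideIf b dE),
    cell dN, cell dW, cell dN, cell dN, cell dN, cell dE, cell dS, cell dS, cell dE, cell dS]

def segFin : List Cell :=
  [cell dW, cell dS, cell dS, cell dW, cell dN, cell dN, cell dW, cell dW]

/-- The cells of a segment: direction of entry and side carrying a negative glue. -/
def Par.seg (P : Par) (j kind i : ℕ) (c b : Bool) : List Cell :=
  match kind with
  | 0 => segStart P.wide
  | 1 => if i = 0 then segInitLast (P.bits j 0) else segInit (P.bits j i)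
  | 2 => if i + 1 < P.w then segInc b (b ^^ c)
    else if c && b then segOver P.wide b (b ^^ c) else segIncLast P.wide b (b ^^ c)
  | 3 => if i = 0 then segCopyLast b else segCopy b
  | 4 => segFin
  | _ => [cell dN]

/-- The first label of the segment after the given one. -/
def Par.nxt (P : Par) (j kind i : ℕ) (c b : Bool) : Label :=
  match kind with
  | 0 => (j, 1, P.w - 1, false, false, 0)
  | 1 => if i = 0 then (j, 2, 0, true, false, 0) else (j, 1, i - 1, false, false, 0)
  | 2 => if i + 1 < P.w then (j, 2, i + 1, c && b, false, 0)
    else if c && b then (j, 4, P.w - 1, false, false, 0) else (j, 3, P.w - 1, false, false, 0)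
  | 3 => if i = 0 then (j, 2, 0, true, false, 0) else (j, 3, i - 1, false, false, 0)
  | 4 => if i = 0 then (if j < 3 then (j + 1, 0, 0, false, false, 0)
      else (j, 5, 5, false, false, 0)) else (j, 4, i - 1, false, false, 0)
  | _ => if i = 0 then (j, 6, 0, false, false, 0) else (j, 5, i - 1, false, false, 0)

/-- The global direction of the glue carrying a label. -/
def Par.gdir (P : Par) : Label → Pos
  | (_, 6, _) => dN
  | (_, 7, _) => dE
  | (j, kind, i, c, b, k) => rot j ((P.seg j kind i c b).getD k (cell dN)).1

def Par.inLab (j kind i : ℕ) (c b : Bool) (k : ℕ) : Label :=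
  (j, kind, i, c, if k = 0 then false else b, k)

def Par.outLab (P : Par) (j kind i : ℕ) (c b : Bool) (k : ℕ) : Label :=
  if k + 1 < (P.seg j kind i c b).length then (j, kind, i, c, b, k + 1) else P.nxt j kind i c b

def startLab : Label := (0, 0, 0, false, false, 0)

def Par.glue (P : Par) (l l' : Label) (u : Pos) : Option ℕ :=
  if u = -P.gdir l ∧ l ≠ startLab then some (code l)
  else if u = P.gdir l' then some (code l') else none

def Par.pathTile (P : Par) (s : ℤ) (j kind i : ℕ) (c b : Bool) (k : ℕ) : Tile :=
  mkTile s (P.glue (Par.inLab j kind i c b k) (P.outLab j kind i c b k))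
    (((P.seg j kind i c b).getD k (cell dN)).2.map (rot j))

def vLab : Label := (3, 6, 0, false, false, 0)

def hLab : Label := (3, 7, 0, false, false, 0)

def vTile (s : ℤ) : Tile :=
  mkTile s (fun u => if u = dS then some (code vLab) else if u = dN then some (code vLab)
    else if u = dE then some (code hLab) else none) none

def hTile (s : ℤ) : Tile :=
  mkTile s (fun u => if u = dW then some (code hLab) else if u = dE then some (code hLab)
    else none) none

/-- Only segments of kinds 2 and 3 guess a bit. -/
def guess (kind : ℕ) (b : Bool) : Bool := b && (kind == 2 || kind == 3)

/-- The full tile set. -/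
noncomputable def Par.tileSet (P : Par) : Finset Tile :=
  insert (vTile 1) (insert (hTile 1)
    ((Finset.range 4 ×ˢ Finset.range 6 ×ˢ Finset.range P.w ×ˢ Finset.univ (α := Bool) ×ˢ
      Finset.univ (α := Bool) ×ˢ Finset.range 24).image
      fun l => P.pathTile 1 l.1 l.2.1 l.2.2.1 l.2.2.2.1 (guess l.2.1 l.2.2.2.2.1) l.2.2.2.2.2))

theorem Par.card_tileSet (P : Par) : P.tileSet.card ≤ 2304 * P.w + 2 := by
  unfold Par.tileSet
  refine (Finset.card_insert_le _ _).trans ?_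
  refine Nat.succ_le_succ ((Finset.card_insert_le _ _).trans (Nat.succ_le_succ ?_))
  refine Finset.card_image_le.trans ?_
  simp only [Finset.card_product, Finset.card_range, Finset.card_univ, Fintype.card_bool]
  apply le_of_eq
  ring

theorem Par.mem_tileSet_image (P : Par) {s : ℤ} {t : Tile} :
    t ∈ P.tileSet.image (reStr s) ↔ t = vTile s ∨ t = hTile s ∨
      ∃ j kind i c b k, j < 4 ∧ kind < 6 ∧ i < P.w ∧ k < 24 ∧
        t = P.pathTile s j kind i c (guess kind b) k := by
  simp only [Par.tileSet, Finset.image_insert, Finset.mem_insert, Finset.image_image,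
    Finset.mem_image, Finset.mem_product, Finset.mem_range, Finset.mem_univ, true_and,
    Prod.exists, Function.comp, vTile, hTile, Par.pathTile, reStr_mkTile]
  constructor
  · rintro (h | h | ⟨j, kind, i, c, b, k, ⟨h1, h2, h3, h4⟩, rfl⟩)
    · exact Or.inl h
    · exact Or.inr (Or.inl h)
    · exact Or.inr (Or.inr ⟨j, kind, i, c, b, k, h1, h2, h3, h4, rfl⟩)
  · rintro (h | h | ⟨j, kind, i, c, b, k, h1, h2, h3, h4, rfl⟩)
    · exact Or.inl h
    · exact Or.inr (Or.inl h)
    · exact Or.inr (Or.inr ⟨j, kind, i, c, b, k, ⟨h1, h2, h3, h4⟩, rfl⟩)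

theorem glueRestricted_of_mkTile {T : Finset Tile} (h : ∀ t ∈ T, ∃ g neg, t = mkTile 1 g neg)
    (hex : ∃ t ∈ T, ∃ g u, u ∈ U2 ∧ t = mkTile 1 g (some u)) : GlueRestricted T := by
  refine ⟨fun t ht u _ => ?_, 0, ?_, ?_⟩
  · obtain ⟨g, neg, rfl⟩ := h t ht
    simp only [mkTile]
    split_ifs <;> simp
  · obtain ⟨t, ht, g, u, hu, rfl⟩ := hex
    exact ⟨_, ht, u, hu, (mkTile_neg rfl).2, (mkTile_neg rfl).1⟩
  · rintro c ⟨t, ht, u, -, rfl, hstr⟩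
    obtain ⟨g, neg, rfl⟩ := h t ht
    by_cases hn : neg = some u
    · exact (mkTile_neg hn).2
    · have := mkTile_nonneg (s := 1) (g := g) hn
      omega

theorem Par.glueRestricted (P : Par) (hw : 0 < P.w) : GlueRestricted P.tileSet := by
  have key : ∀ t, t ∈ P.tileSet ↔ t ∈ P.tileSet.image (reStr 1) := by
    intro t
    rw [P.mem_tileSet_image]
    simp only [Par.tileSet, Finset.mem_insert,
      Finset.mem_image, Finset.mem_product, Finset.mem_range, Finset.mem_univ, true_and,
      Prod.exists]
    refine or_congr_right (or_congr_right ?_)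
    constructor
    · rintro ⟨j, kind, i, c, b, k, ⟨h1, h2, h3, h4⟩, rfl⟩
      exact ⟨j, kind, i, c, b, k, h1, h2, h3, h4, rfl⟩
    · rintro ⟨j, kind, i, c, b, k, h1, h2, h3, h4, rfl⟩
      exact ⟨j, kind, i, c, b, k, ⟨h1, h2, h3, h4⟩, rfl⟩
  refine glueRestricted_of_mkTile (fun t ht => ?_) ?_
  · rw [key, P.mem_tileSet_image] at ht
    rcases ht with rfl | rfl | ⟨j, kind, i, c, b, k, -, -, -, -, rfl⟩
    · exact ⟨_, _, rfl⟩
    · exact ⟨_, _, rfl⟩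
    · exact ⟨_, _, rfl⟩
  · refine ⟨P.pathTile 1 0 3 0 false (guess 3 true) 0, ?_, _, dS, by decide, rfl⟩
    rw [key, P.mem_tileSet_image]
    exact Or.inr (Or.inr ⟨0, 3, 0, false, true, 0, by omega, by omega, hw, by omega, rfl⟩)

theorem Par.seg_dir_mem (P : Par) (j kind i : ℕ) (c b : Bool) :
    ∀ x ∈ P.seg j kind i c b, x.1 ∈ U2 := by
  have h0 : ∀ a, ∀ x ∈ segStart a, x.1 ∈ U2 := by decide
  have h1 : ∀ v, ∀ x ∈ segInit v, x.1 ∈ U2 := by decide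
  have h2 : ∀ v, ∀ x ∈ segInitLast v, x.1 ∈ U2 := by decide
  have h3 : ∀ b v, ∀ x ∈ segInc b v, x.1 ∈ U2 := by decide
  have h4 : ∀ a b v, ∀ x ∈ segIncLast a b v, x.1 ∈ U2 := by decide
  have h5 : ∀ a b v, ∀ x ∈ segOver a b v, x.1 ∈ U2 := by decide
  have h6 : ∀ v, ∀ x ∈ segCopy v, x.1 ∈ U2 := by decide
  have h7 : ∀ v, ∀ x ∈ segCopyLast v, x.1 ∈ U2 := by decide
  have h8 : ∀ x ∈ segFin, x.1 ∈ U2 := by decide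
  have h9 : ∀ x ∈ [cell dN], x.1 ∈ U2 := by decide
  unfold Par.seg
  split
  · exact h0 _
  · split_ifs
    · exact h2 _
    · exact h1 _
  · split_ifs
    · exact h3 _ _
    · exact h5 _ _ _
    · exact h4 _ _ _
  · split_ifs
    · exact h7 _
    · exact h6 _
  · exact h8
  · exact h9

theorem Par.getD_dir_mem (P : Par) (j kind i : ℕ) (c b : Bool) (k : ℕ) :
    ((P.seg j kind i c b).getD k (cell dN)).1 ∈ U2 := by
  by_cases hk : k < (P.seg j kind i c b).length
  · rw [List.getD_eq_getElem _ _ hk]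
    exact P.seg_dir_mem j kind i c b _ (List.getElem_mem _)
  · rw [List.getD_eq_default _ _ (not_lt.1 hk)]
    decide

theorem Par.gdir_mem (P : Par) (l : Label) : P.gdir l ∈ U2 := by
  unfold Par.gdir
  split
  · decide
  · decide
  · exact rot_mem _ (P.getD_dir_mem _ _ _ _ _ _)

theorem Par.gdir_of_lt (P : Par) {j kind i : ℕ} {c b : Bool} {k : ℕ} (hk : kind < 6) :
    P.gdir (j, kind, i, c, b, k) = rot j ((P.seg j kind i c b).getD k (cell dN)).1 := by
  unfold Par.gdir
  split
  · simp_all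
  · simp_all
  · simp_all

theorem Par.gdir_inLab (P : Par) {j kind i : ℕ} {c b : Bool} {k : ℕ} (hk : kind < 6) :
    P.gdir (Par.inLab j kind i c b k) =
      rot j ((P.seg j kind i c b).getD k (cell dN)).1 := by
  unfold Par.inLab
  split_ifs with h0
  · rw [P.gdir_of_lt hk]
    congr 1
    subst h0
    cases b
    · rfl
    · have key : kind = 0 ∨ kind = 1 ∨ kind = 2 ∨ kind = 3 ∨ kind = 4 ∨ kind = 5 := by omega
      rcases key with rfl | rfl | rfl | rfl | rfl | rfl
      · rfl
      · rfl
      · simp only [Par.seg]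
        split_ifs <;> cases P.wide <;> rfl
      · simp only [Par.seg]
        split_ifs <;> rfl
      · rfl
      · rfl
  · exact P.gdir_of_lt hk

/-- A tile matching the glue of a path label is a path tile with that input label. -/
theorem Par.candidate (P : Par) {s : ℤ} (hs : 1 ≤ s) {t : Tile}
    (ht : t ∈ P.tileSet.image (reStr s)) {l : Label} (hl : l.2.1 < 6)
    (hc : t.col (-P.gdir l) = code l) (hstr : t.str (-P.gdir l) = 1) :
    ∃ j kind i c b k, t = P.pathTile s j kind i c (guess kind b) k ∧
      Par.inLab j kind i c (guess kind b) k = l := by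
  rw [P.mem_tileSet_image] at ht
  have hgl := P.gdir_mem l
  rcases ht with rfl | rfl | ⟨j, kind, i, c, b, k, -, -, -, -, rfl⟩
  · exfalso
    have := mkTile_pos hs (u := -P.gdir l) (by rw [← vTile, hstr]; decide)
    rw [← vTile, hc] at this
    split_ifs at this <;>
    · have := code_injective (Option.some.inj this)
      rw [← this] at hl
      simp [vLab, hLab] at hl
  · exfalso
    have := mkTile_pos hs (u := -P.gdir l) (by rw [← hTile, hstr]; decide)
    rw [← hTile, hc] at this
    split_ifs at this <;>
    · have := code_injective (Option.some.inj this)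
      rw [← this] at hl
      simp [hLab] at hl
  · refine ⟨j, kind, i, c, b, k, rfl, ?_⟩
    have := mkTile_pos hs (u := -P.gdir l) (by rw [← Par.pathTile, hstr]; decide)
    rw [← Par.pathTile, hc] at this
    unfold Par.glue at this
    split_ifs at this with h1 h2
    · exact code_injective (Option.some.inj this)
    · have e := code_injective (Option.some.inj this)
      rw [e] at h2
      exact absurd h2.symm (ne_neg_of_mem_U2 hgl)

theorem map_rot_eq {j : ℕ} {o : Option Pos} {u : Pos} :
    o.map (rot j) = some (rot j u) ↔ o = some u := by
  constructor
  · intro h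
    obtain ⟨v, hv, e⟩ := Option.map_eq_some_iff.1 h
    rw [hv, rot_injective j e]
  · rintro rfl; rfl

/-- The tile at local position `z` of strip `j` has its negative glue exactly on the local
side given by `o`. -/
def Par.NegIs (P : Par) (s : ℤ) (α : Assembly) (j : ℕ) (z : Pos) (o : Option Pos) : Prop :=
  ∃ t, α (P.emb j z) = some t ∧ ∀ u, (o = some u → t.str (rot j u) = -s ∧ t.col (rot j u) = 0) ∧
    (o ≠ some u → 0 ≤ t.str (rot j u))

theorem Par.NegIs.extends {P : Par} {s : ℤ} {α β : Assembly} {j : ℕ} {z : Pos} {o : Option Pos}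
    (h : P.NegIs s α j z o) (hαβ : Extends α β) : P.NegIs s β j z o := by
  obtain ⟨t, ht, h⟩ := h
  exact ⟨t, by rw [hαβ _ (by simp [ht]), ht], h⟩

theorem Par.negIs_pathTile (P : Par) {s : ℤ} {α : Assembly} {j kind i : ℕ} {c b : Bool}
    {k : ℕ} {z : Pos} (h : α (P.emb j z) = some (P.pathTile s j kind i c b k)) :
    P.NegIs s α j z ((P.seg j kind i c b).getD k (cell dN)).2 :=
  ⟨_, h, fun _ => ⟨fun h => mkTile_neg (map_rot_eq.2 h),
    fun h => mkTile_nonneg (fun h' => h (map_rot_eq.1 h'))⟩⟩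

/-- The tile assembly systems under consideration. -/
structure Par.Sys (P : Par) (s : ℤ) (𝒯 : TAS) : Prop where
  pos : 1 ≤ s
  temp : 𝒯.temp = 1
  tiles : 𝒯.tiles = P.tileSet.image (reStr s)

theorem Par.Sys.str_le {P : Par} {s : ℤ} {𝒯 : TAS} (h𝒯 : P.Sys s 𝒯) :
    ∀ t ∈ 𝒯.tiles, ∀ u, t.str u ≤ 1 := by
  intro t ht u
  rw [h𝒯.tiles, P.mem_tileSet_image] at ht
  rcases ht with rfl | rfl | ⟨j, kind, i, c, b, k, -, -, -, -, rfl⟩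
  · exact mkTile_str_le h𝒯.pos _ _ _
  · exact mkTile_str_le h𝒯.pos _ _ _
  · exact mkTile_str_le h𝒯.pos _ _ _

/-- One cell of a segment. -/
theorem Par.cell_step {P : Par} {s : ℤ} {𝒯 : TAS} (h𝒯 : P.Sys s 𝒯) {α : Assembly}
    {j kind i : ℕ} {c b : Bool} {k : ℕ} (hj : j < 4) (hkind : kind < 6) (hi : i < P.w)
    (hb : guess kind b = b) (hk : k < 24) {z d d' : Pos} {m : Option Pos}
    (hcell : (P.seg j kind i c b).getD k (cell dN) = (d, m))
    (hstart : Par.inLab j kind i c b k ≠ startLab)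
    (htip : Tip α (P.emb j z) (rot j d) (code (Par.inLab j kind i c b k)))
    (hmd : m ≠ some (-d)) (hmo : m ≠ some d')
    (hout : P.gdir (P.outLab j kind i c b k) = rot j d')
    (hfree : α (P.emb j (z + d')) = none)
    (hright : ∀ u, m = some u → ∀ t', α (P.emb j (z + u)) = some t' → 0 ≤ t'.str (rot j (-u)))
    (hother : k = 0 → kind = 2 ∨ kind = 3 → ∃ u ∈ U2, u ≠ -d ∧
      ((P.seg j kind i c (!b)).getD 0 (cell dN)).2 = some u ∧
      ∃ t', α (P.emb j (z + u)) = some t' ∧ t'.str (rot j (-u)) = -s ∧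
        t'.col (rot j (-u)) = 0) :
    UStep 𝒯 α (Function.update α (P.emb j z) (some (P.pathTile s j kind i c b k))) ∧
      Tip (Function.update α (P.emb j z) (some (P.pathTile s j kind i c b k)))
        (P.emb j (z + d')) (rot j d') (code (P.outLab j kind i c b k)) := by
  have hgd : P.gdir (Par.inLab j kind i c b k) = rot j d := by
    rw [P.gdir_inLab hkind, hcell]
  have hdd : d' ≠ -d := by
    rintro rfl
    obtain ⟨t', ht', -⟩ := htip.tip
    rw [P.emb_add, rot_neg, ← sub_eq_add_neg, ht'] at hfree
    simp at hfree
  have hin := mkTile_of_ne (s := s)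
    (g := P.glue (Par.inLab j kind i c b k) (P.outLab j kind i c b k))
    (neg := ((P.seg j kind i c b).getD k (cell dN)).2.map (rot j)) (u := -rot j d)
    (a := code (Par.inLab j kind i c b k))
    (by rw [hcell, ← rot_neg]; exact fun h => hmd (map_rot_eq.1 h))
    (by unfold Par.glue; rw [if_pos ⟨by rw [hgd], hstart⟩])
  have ho := mkTile_of_ne (s := s)
    (g := P.glue (Par.inLab j kind i c b k) (P.outLab j kind i c b k))
    (neg := ((P.seg j kind i c b).getD k (cell dN)).2.map (rot j)) (u := rot j d')
    (a := code (P.outLab j kind i c b k))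
    (by rw [hcell]; exact fun h => hmo (map_rot_eq.1 h))
    (by
      unfold Par.glue
      rw [if_neg, if_pos hout.symm]
      rintro ⟨h, -⟩
      rw [hgd, ← rot_neg] at h
      exact hdd (rot_injective j h))
  have hmem : P.pathTile s j kind i c b k ∈ 𝒯.tiles := by
    rw [h𝒯.tiles, P.mem_tileSet_image]
    exact Or.inr (Or.inr ⟨j, kind, i, c, b, k, hj, hkind, hi, hk, by rw [hb]⟩)
  have hgl := P.gdir_mem (P.outLab j kind i c b k)
  rw [hout] at hgl
  rw [P.emb_add]
  refine htip.step h𝒯.temp hmem hin.2 hin.1 h𝒯.str_le ?_ ?_ hgl ho.2 ho.1 ?_ ?_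
  · intro u hu hne t' ht'
    by_cases h : ((P.seg j kind i c b).getD k (cell dN)).2.map (rot j) = some u
    · rw [hcell] at h
      obtain ⟨v, hv, rfl⟩ := Option.map_eq_some_iff.1 h
      right
      rw [← P.emb_add] at ht'
      have := hright v hv t' ht'
      rwa [rot_neg] at this
    · exact Or.inl (mkTile_nonneg h)
  · intro t₂ ht₂ hne hc hstr
    rw [h𝒯.tiles] at ht₂
    rw [← hgd] at hc hstr
    obtain ⟨j', kind', i', c', b', k', rfl, hl⟩ := P.candidate h𝒯.pos ht₂ hkind hc hstr
    simp only [Par.inLab, Prod.mk.injEq] at hl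
    obtain ⟨rfl, rfl, rfl, rfl, hbb, rfl⟩ := hl
    by_cases hk0 : k' = 0
    · subst hk0
      have hbne : guess kind' b' ≠ b := by rintro rfl; exact hne rfl
      have hk23 : kind' = 2 ∨ kind' = 3 := by
        by_contra hcon
        have : (kind' == 2 || kind' == 3) = false := by simpa using hcon
        unfold guess at hbne hb
        rw [this, Bool.and_false] at hbne hb
        exact hbne hb
      obtain ⟨u, hu, hud, hum, t', ht', hstr', hcol'⟩ := hother rfl hk23
      have hbb' : guess kind' b' = !b := by
        revert hbne
        cases guess kind' b' <;> cases b <;> simp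
      refine ⟨rot j' u, rot_mem j' hu, ?_, t', ?_, ?_⟩
      · rw [← rot_neg]; exact fun h => hud (rot_injective j' h)
      · rw [← P.emb_add, ht']
      · have hneg := mkTile_neg (s := s) (g := P.glue (Par.inLab j' kind' i' c' (!b) 0)
          (P.outLab j' kind' i' c' (!b) 0))
          (neg := ((P.seg j' kind' i' c' (!b)).getD 0 (cell dN)).2.map (rot j')) (u := rot j' u)
          (by rw [hum]; rfl)
        rw [rot_neg] at hstr' hcol'
        have e : interaction (P.pathTile s j' kind' i' c' (guess kind' b') 0) t' (rot j' u) =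
            -s := by
          rw [hbb']
          unfold interaction Par.pathTile
          rw [hneg.1, hneg.2, hstr', hcol']
          simp
        rw [e]
        have := h𝒯.pos
        omega
    · rw [if_neg hk0, if_neg hk0] at hbb
      rw [hbb] at hne
      exact absurd rfl hne
  · intro u _ hpos
    have := mkTile_pos h𝒯.pos hpos
    unfold Par.glue at this
    split_ifs at this with h1 h2
    · left; rw [h1.1, hgd]
    · right; rw [h2, hout]
  · rwa [← P.emb_add]

def dirs (L : List Cell) (dl : Pos) : List Pos := L.map Prod.fst ++ [dl]

/-- Displacement of the `k`-th cell of a segment from its first cell. -/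
def off (L : List Cell) (dl : Pos) (k : ℕ) : Pos := (((dirs L dl).take (k + 1)).drop 1).sum

def mark (L : List Cell) (k : ℕ) : Option Pos := (L.getD k (cell dN)).2

def offs (L : List Cell) (dl : Pos) : List Pos := (List.range L.length).map (off L dl)

/-- Displacements of the positions that have to be empty before a segment starts. -/
def needs (L : List Cell) (dl : Pos) : List Pos :=
  offs L dl ++ (List.range' 1 (L.length - 1)).filterMap fun k => (mark L k).map (off L dl k + ·)

/-- Consistency of a segment with direction `dl` of departure. -/
def SegOK (L : List Cell) (dl : Pos) : Prop :=
  0 < L.length ∧ L.length ≤ 24 ∧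
  (∀ k < L.length, mark L k ≠ some (-(dirs L dl).getD k 0) ∧
    mark L k ≠ some ((dirs L dl).getD (k + 1) 0)) ∧
  (∀ k ≤ L.length, ∀ m < k, off L dl m ≠ off L dl k) ∧
  (∀ k < L.length, 0 < k → ∀ m < k, (mark L k).map (off L dl k + ·) ≠ some (off L dl m))

instance (L : List Cell) (dl : Pos) : Decidable (SegOK L dl) := by
  unfold SegOK; infer_instance

theorem off_zero (L : List Cell) (dl : Pos) : off L dl 0 = 0 := by
  unfold off dirs
  cases L <;> simp

theorem off_succ (L : List Cell) (dl : Pos) {k : ℕ} (hk : k < L.length) :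
    off L dl (k + 1) = off L dl k + (dirs L dl).getD (k + 1) 0 := by
  have hlen : k + 1 < (dirs L dl).length := by simp [dirs]; omega
  unfold off
  rw [List.take_add_one, List.drop_append_of_le_length (by simp; omega), List.sum_append,
    List.getElem?_eq_getElem hlen, List.getD_eq_getElem _ _ hlen]
  simp

theorem dirs_getD (L : List Cell) (dl : Pos) {k : ℕ} (hk : k < L.length) :
    (dirs L dl).getD k 0 = (L.getD k (cell dN)).1 := by
  unfold dirs
  rw [List.getD_append _ _ _ _ (by simpa using hk), List.getD_eq_getElem _ _ (by simpa using hk),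
    List.getD_eq_getElem _ _ hk]
  simp

theorem dirs_getD_length (L : List Cell) (dl : Pos) : (dirs L dl).getD L.length 0 = dl := by
  simp [dirs]

theorem mem_offs {L : List Cell} {dl q : Pos} :
    q ∈ offs L dl ↔ ∃ k < L.length, off L dl k = q := by simp [offs]

theorem adom_update {α : Assembly} {p : Pos} {t : Tile} :
    adom (Function.update α p (some t)) = insert p (adom α) := by
  ext x
  by_cases hx : x = p
  · subst hx; simp [adom]
  · simp [adom, hx]

theorem eq_none_of_notMem_adom {α : Assembly} {p : Pos} (h : p ∉ adom α) : α p = none := by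
  by_contra hne
  exact h hne

/-- Reachability by forced steps. -/
abbrev Run (𝒯 : TAS) : Assembly → Assembly → Prop := Relation.ReflTransGen (UStep 𝒯)

/-- The effect of growing the cells `k₀, …, k - 1` of a segment whose first cell is at `z`. -/
structure Par.SegRun (P : Par) (s : ℤ) (𝒯 : TAS) (α α' : Assembly) (j : ℕ) (L : List Cell)
    (dl z : Pos) (k₀ k : ℕ) : Prop where
  run : Run 𝒯 α α'
  dom : adom α' = adom α ∪ P.emb j '' {q | ∃ m, k₀ ≤ m ∧ m < k ∧ q = z + off L dl m}
  marks : ∀ m, k₀ ≤ m → m < k → P.NegIs s α' j (z + off L dl m) (mark L m)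

theorem Par.seg_run {P : Par} {s : ℤ} {𝒯 : TAS} (h𝒯 : P.Sys s 𝒯) {α : Assembly}
    {j kind i : ℕ} {c b : Bool} (hj : j < 4) (hkind : kind < 6) (hi : i < P.w)
    (hb : guess kind b = b) {L : List Cell} (hL : P.seg j kind i c b = L) {dl z : Pos}
    (hok : SegOK L dl) (hdl : P.gdir (P.nxt j kind i c b) = rot j dl)
    (k₀ : ℕ) (hk₀ : k₀ < L.length) (hstart : k₀ = 0 → Par.inLab j kind i c b 0 ≠ startLab)
    (htip : Tip α (P.emb j (z + off L dl k₀)) (rot j ((dirs L dl).getD k₀ 0))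
      (code (Par.inLab j kind i c b k₀)))
    (hfree : ∀ m, k₀ ≤ m → m ≤ L.length → α (P.emb j (z + off L dl m)) = none)
    (hfree' : ∀ m, 0 < m → m < L.length → ∀ u, mark L m = some u →
      α (P.emb j (z + off L dl m + u)) = none)
    (hright : ∀ u, mark L 0 = some u → ∀ t', α (P.emb j (z + u)) = some t' →
      0 ≤ t'.str (rot j (-u)))
    (hother : kind = 2 ∨ kind = 3 → ∃ u ∈ U2, u ≠ -(L.getD 0 (cell dN)).1 ∧
      ((P.seg j kind i c (!b)).getD 0 (cell dN)).2 = some u ∧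
      ∃ t', α (P.emb j (z + u)) = some t' ∧ t'.str (rot j (-u)) = -s ∧
        t'.col (rot j (-u)) = 0) :
    ∃ α', P.SegRun s 𝒯 α α' j L dl z k₀ L.length ∧
      Tip α' (P.emb j (z + off L dl L.length)) (rot j dl) (code (P.nxt j kind i c b)) := by
  obtain ⟨-, hlen, hmk, hnd, hnb⟩ := hok
  have key : ∀ k, k₀ ≤ k → k ≤ L.length → ∃ α', P.SegRun s 𝒯 α α' j L dl z k₀ k ∧
      Tip α' (P.emb j (z + off L dl k)) (rot j ((dirs L dl).getD k 0))
        (code (if k < L.length then Par.inLab j kind i c b k else P.nxt j kind i c b)) := by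
    intro k hk
    induction k, hk using Nat.le_induction with
    | base =>
      intro _
      refine ⟨α, ⟨Relation.ReflTransGen.refl, ?_, fun m h1 h2 => absurd h1 (by omega)⟩, ?_⟩
      · have : {q : Pos | ∃ m, k₀ ≤ m ∧ m < k₀ ∧ q = z + off L dl m} = ∅ := by
          ext q
          simp only [Set.mem_ofPred_eq, Set.mem_empty_iff_false, iff_false]
          rintro ⟨m, h1, h2, -⟩
          omega
        rw [this, Set.image_empty, Set.union_empty]
      · rw [if_pos hk₀]; exact htip
    | succ k hk ih =>
      intro hkl
      obtain ⟨α', hrun, ht⟩ := ih (by omega)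
      have hkL : k < L.length := by omega
      rw [if_pos hkL] at ht
      have hnone : ∀ p, α (P.emb j p) = none → (∀ m < k, off L dl m ≠ p - z) →
          α' (P.emb j p) = none := by
        intro p hp hm
        refine eq_none_of_notMem_adom ?_
        rw [hrun.dom]
        rintro (h | ⟨q, ⟨m, -, h2, rfl⟩, h⟩)
        · exact h hp
        · have := P.emb_injective j h
          exact hm m h2 (by rw [← this]; abel)
      have hext := extends_of_run hrun.run
      have hcell : (P.seg j kind i c b).getD k (cell dN) = ((dirs L dl).getD k 0, mark L k) := by
        rw [hL, dirs_getD L dl hkL]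
        rfl
      have hol : P.outLab j kind i c b k =
          if k + 1 < L.length then Par.inLab j kind i c b (k + 1) else P.nxt j kind i c b := by
        unfold Par.outLab Par.inLab
        rw [hL]
        simp
      have step := P.cell_step h𝒯 (α := α') (z := z + off L dl k) hj hkind hi hb
        (by omega : k < 24) hcell ?_ ht (hmk k hkL).1 (d' := (dirs L dl).getD (k + 1) 0)
        (hmk k hkL).2 ?_ ?_ ?_ ?_
      · refine ⟨_, ⟨hrun.run.tail step.1, ?_, ?_⟩, ?_⟩
        · rw [adom_update, hrun.dom]
          ext x
          simp only [Set.mem_insert_iff, Set.mem_union, Set.mem_image, Set.mem_ofPred_eq]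
          constructor
          · rintro (rfl | h | ⟨q, ⟨m, h1, h2, rfl⟩, rfl⟩)
            · exact Or.inr ⟨_, ⟨k, hk, by omega, rfl⟩, rfl⟩
            · exact Or.inl h
            · exact Or.inr ⟨_, ⟨m, h1, by omega, rfl⟩, rfl⟩
          · rintro (h | ⟨q, ⟨m, h1, h2, rfl⟩, rfl⟩)
            · exact Or.inr (Or.inl h)
            · rcases Nat.lt_succ_iff_lt_or_eq.1 h2 with h2 | rfl
              · exact Or.inr (Or.inr ⟨_, ⟨m, h1, h2, rfl⟩, rfl⟩)
              · exact Or.inl rfl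
        · intro m h1 h2
          rcases Nat.lt_succ_iff_lt_or_eq.1 h2 with h2 | rfl
          · exact (hrun.marks m h1 h2).extends (extends_update _ ht.empty)
          · have := P.negIs_pathTile (s := s) (j := j) (kind := kind) (i := i) (c := c) (b := b)
              (k := m) (z := z + off L dl m) (α := Function.update α'
                (P.emb j (z + off L dl m)) (some (P.pathTile s j kind i c b m))) (by simp)
            rwa [hcell] at this
        · rw [off_succ L dl hkL, ← add_assoc, ← hol]
          exact step.2
      · intro h
        rcases Nat.eq_zero_or_pos k with h0 | h0
        · subst h0
          exact hstart (by omega) h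
        · have : k = 0 := congrArg (fun l : Label => l.2.2.2.2.2) h
          omega
      · rw [hol]
        split_ifs with h
        · rw [P.gdir_inLab hkind, hL, dirs_getD L dl h]
        · have : k + 1 = L.length := by omega
          rw [this, dirs_getD_length, hdl]
      · have := off_succ L dl hkL
        refine hnone _ ?_ fun m hm => ?_
        · rw [add_assoc, ← this]
          exact hfree _ (by omega) hkl
        · rw [add_assoc, ← this, add_sub_cancel_left]
          exact hnd _ hkl m (by omega)
      · intro u hu t' ht'
        rcases Nat.eq_zero_or_pos k with h0 | h0
        · subst h0
          have hk0 : k₀ = 0 := by omega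
          have hd : adom α' = adom α := by
            rw [hrun.dom]
            ext x
            simp
          rw [off_zero, add_zero] at ht'
          refine hright u hu t' ?_
          rw [← ht']
          refine (hext _ fun h => ?_).symm
          have : P.emb j (z + u) ∈ adom α' := by simp [adom, ht']
          rw [hd] at this
          exact this h
        · have := hnone (z + off L dl k + u) (hfree' k h0 hkL u hu) fun m hm e => by
            refine hnb k hkL h0 m hm ?_
            rw [hu, e]
            simp only [Option.map_some]
            congr 1
            abel
          rw [this] at ht'
          simp at ht'
      · rintro rfl hk23
        obtain ⟨u, hu, hud, hum, t', h1, h2⟩ := hother hk23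
        refine ⟨u, hu, ?_, hum, t', ?_, h2⟩
        · rwa [dirs_getD L dl hkL]
        · rw [off_zero, add_zero, hext _ (by simp [h1]), h1]
  obtain ⟨α', h1, h2⟩ := key L.length (by omega) le_rfl
  rw [dirs_getD_length, if_neg (lt_irrefl _)] at h2
  exact ⟨α', h1, h2⟩

/-- The rectangle of local positions of a strip. -/
def Par.Rect (P : Par) (x y : ℤ) : Prop := 0 ≤ x ∧ x < P.W ∧ 0 ≤ y ∧ y < P.N - P.W

/-- Context of the growth of strip `j` on top of an assembly with domain `B`. -/
structure Par.Ctx (P : Par) (s : ℤ) (𝒯 : TAS) (j : ℕ) (B : Set Pos) : Prop where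
  sys : P.Sys s 𝒯
  lt : j < 4
  disj : ∀ x y, P.Rect x y → P.emb j (x, y) ∉ B

/-- In addition to `B`, the assembly `α` occupies the local positions `S`; its tip is at the
local position `(x, y)`, entered in direction `d` with label `l`. -/
structure Par.St (P : Par) (j : ℕ) (B : Set Pos) (α : Assembly) (S : ℤ → ℤ → Prop) (x y : ℤ)
    (d : Pos) (l : Label) : Prop where
  dom : adom α = B ∪ P.emb j '' {p | S p.1 p.2}
  tip : Tip α (P.emb j (x, y)) (rot j d) (code l)

theorem Par.St.free {P : Par} {s : ℤ} {𝒯 : TAS} {j : ℕ} {B : Set Pos} (hC : P.Ctx s 𝒯 j B)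
    {α : Assembly} {S : ℤ → ℤ → Prop} {x y : ℤ} {d : Pos} {l : Label}
    (hS : P.St j B α S x y d l) {x' y' : ℤ} (hr : P.Rect x' y') (hn : ¬ S x' y') :
    α (P.emb j (x', y')) = none := by
  refine eq_none_of_notMem_adom ?_
  rw [hS.dom]
  rintro (h | ⟨p, h, e⟩)
  · exact hC.disj _ _ hr h
  · rw [P.emb_injective j e] at h
    exact hn h

/-- The part of `Q` in the box of size `m × n` at `(a, c)` belongs to the list `l`. -/
def BoxSubset (l : List Pos) (Q : ℤ → ℤ → Prop) (a c : ℤ) (m n : ℕ) : Prop :=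
  ∀ x < m, ∀ y < n, ¬ Q (a + x) (c + y) ∨ ((a + x, c + y) : Pos) ∈ l

instance (l : List Pos) (Q : ℤ → ℤ → Prop) [∀ u v, Decidable (Q u v)] (a c : ℤ) (m n : ℕ) :
    Decidable (BoxSubset l Q a c m n) := by unfold BoxSubset; infer_instance

theorem mem_iff_of_box {l : List Pos} {Q : ℤ → ℤ → Prop} (a c : ℤ) (m n : ℕ)
    (h1 : ∀ q ∈ l, Q q.1 q.2)
    (h2 : BoxSubset l Q a c m n)
    (h3 : ∀ x y, Q x y → a ≤ x ∧ x < a + m ∧ c ≤ y ∧ y < c + n) (x y : ℤ) :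
    (x, y) ∈ l ↔ Q x y := by
  refine ⟨fun h => h1 _ h, fun h => ?_⟩
  obtain ⟨h4, h5, h6, h7⟩ := h3 x y h
  have := h2 (x - a).toNat (by omega) (y - c).toNat (by omega)
  rw [Int.toNat_of_nonneg (by omega), Int.toNat_of_nonneg (by omega), add_sub_cancel,
    add_sub_cancel] at this
  exact this.resolve_left (not_not.2 h)

theorem mem_needs_off {L : List Cell} {dl : Pos} {m : ℕ} (hm : m < L.length) :
    off L dl m ∈ needs L dl :=
  List.mem_append_left _ (mem_offs.2 ⟨m, hm, rfl⟩)

theorem mem_needs_mark {L : List Cell} {dl u : Pos} {m : ℕ} (h0 : 0 < m) (hm : m < L.length)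
    (hu : mark L m = some u) : off L dl m + u ∈ needs L dl := by
  refine List.mem_append_right _ (List.mem_filterMap.2 ⟨m, ?_, by rw [hu]; rfl⟩)
  rw [List.mem_range'_1]
  omega

/-- Growth of a whole segment, in local coordinates. -/
theorem Par.St.seg {P : Par} {s : ℤ} {𝒯 : TAS} {j : ℕ} {B : Set Pos} (hC : P.Ctx s 𝒯 j B)
    {α : Assembly} {S : ℤ → ℤ → Prop} {x y : ℤ} {d : Pos} {kind i : ℕ} {c b : Bool}
    (hS : P.St j B α S x y d (j, kind, i, c, false, 0))
    (hkind : kind < 6) (hi : i < P.w) (hb : guess kind b = b)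
    (hstart : ((j, kind, i, c, false, 0) : Label) ≠ startLab)
    {L : List Cell} (hL : P.seg j kind i c b = L) {dl : Pos}
    (hok : SegOK L dl) (hdl : P.gdir (P.nxt j kind i c b) = rot j dl)
    (hd : (L.getD 0 (cell dN)).1 = d)
    {F : ℤ → ℤ → Prop} (hneed : ∀ q ∈ needs L dl, F q.1 q.2)
    (hF : ∀ u v, F u v → P.Rect (x + u) (y + v) ∧ ¬ S (x + u) (y + v))
    {x' y' : ℤ} (hx' : x' = x + (off L dl L.length).1) (hy' : y' = y + (off L dl L.length).2)
    (hend : α (P.emb j (x', y')) = none)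
    (hright : ∀ u, mark L 0 = some u → ∀ t', α (P.emb j ((x, y) + u)) = some t' →
      0 ≤ t'.str (rot j (-u)))
    (hother : kind = 2 ∨ kind = 3 → ∃ u ∈ U2, u ≠ -(L.getD 0 (cell dN)).1 ∧
      ((P.seg j kind i c (!b)).getD 0 (cell dN)).2 = some u ∧
      ∃ t', α (P.emb j ((x, y) + u)) = some t' ∧ t'.str (rot j (-u)) = -s ∧
        t'.col (rot j (-u)) = 0)
    {Q : ℤ → ℤ → Prop} (hQ : ∀ u v, (u, v) ∈ offs L dl ↔ Q u v)
    {S' : ℤ → ℤ → Prop} (hS' : ∀ u v, S' u v ↔ S u v ∨ Q (u - x) (v - y)) :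
    ∃ α', Run 𝒯 α α' ∧ P.St j B α' S' x' y' dl (P.nxt j kind i c b) ∧
      ∀ m < L.length, P.NegIs s α' j ((x, y) + off L dl m) (mark L m) := by
  have hpos := hok.1
  have hfr : ∀ q ∈ needs L dl, α (P.emb j ((x, y) + q)) = none := fun q hq =>
    hS.free hC (hF _ _ (hneed q hq)).1 (hF _ _ (hneed q hq)).2
  have he : ((x, y) : Pos) + off L dl L.length = (x', y') := by ext <;> simp [hx', hy']
  obtain ⟨α', h1, h2⟩ := P.seg_run hC.sys (α := α) hC.lt hkind hi hb hL (z := (x, y)) hok hdl 0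
    hpos (fun _ => hstart) (by
      rw [off_zero, add_zero, dirs_getD L dl hpos, hd]
      exact hS.tip) (by
      intro m _ hm
      rcases Nat.lt_or_eq_of_le hm with hm | rfl
      · exact hfr _ (mem_needs_off hm)
      · rw [he]; exact hend) (by
      intro m h0 hm u hu
      rw [add_assoc]
      exact hfr _ (mem_needs_mark h0 hm hu)) hright hother
  refine ⟨α', h1.run, ⟨?_, ?_⟩, fun m hm => h1.marks m (Nat.zero_le _) hm⟩
  · rw [h1.dom, hS.dom, Set.union_assoc, ← Set.image_union]
    congr 2
    ext ⟨u, v⟩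
    simp only [Set.mem_union, Set.mem_ofPred_eq, hS', ← hQ, mem_offs]
    refine or_congr_right ⟨?_, ?_⟩
    · rintro ⟨m, -, hm, e⟩
      exact ⟨m, hm, by
        have := congrArg (· - ((x, y) : Pos)) e
        simpa using this.symm⟩
    · rintro ⟨m, hm, e⟩
      exact ⟨m, Nat.zero_le _, hm, by rw [e]; ext <;> simp⟩
  · rw [← he]; exact h2

/-- A bit stored below and to the left of a dent. -/
def Par.DentA (P : Par) (s : ℤ) (α : Assembly) (j : ℕ) (h : ℤ) (m : ℕ) (v : Bool) : Prop :=
  P.NegIs s α j (4 * m + 2, h) (sideIf (!v) dN) ∧ P.NegIs s α j (4 * m + 1, h + 1) (sideIf v dE)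

/-- A bit stored below and to the right of a dent. -/
def Par.DentB (P : Par) (s : ℤ) (α : Assembly) (j : ℕ) (h : ℤ) (m : ℕ) (v : Bool) : Prop :=
  P.NegIs s α j (4 * m + 3, h) (sideIf (!v) dN) ∧ P.NegIs s α j (4 * m + 4, h + 1) (sideIf v dW)

theorem Par.DentA.extends {P : Par} {s : ℤ} {α β : Assembly} {j : ℕ} {h : ℤ} {m : ℕ} {v : Bool}
    (hd : P.DentA s α j h m v) (hαβ : Extends α β) : P.DentA s β j h m v :=
  ⟨hd.1.extends hαβ, hd.2.extends hαβ⟩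

theorem Par.DentB.extends {P : Par} {s : ℤ} {α β : Assembly} {j : ℕ} {h : ℤ} {m : ℕ} {v : Bool}
    (hd : P.DentB s α j h m v) (hαβ : Extends α β) : P.DentB s β j h m v :=
  ⟨hd.1.extends hαβ, hd.2.extends hαβ⟩

/-- Being below the profile of a strip at level `h`. -/
def Par.Low (P : Par) (h x y : ℤ) : Prop := y ≤ h ∨ y ≤ h + 2 ∧ (x % 4 < 2 ∨ 4 * P.w ≤ x)

def Par.SA (P : Par) (h : ℤ) (i : ℕ) (x y : ℤ) : Prop :=
  0 ≤ x ∧ x < P.W ∧ 0 ≤ y ∧ (x < 4 * i + 2 ∧ P.Low (h + 3) x y ∨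
    x = 4 * i + 2 ∧ (y ≤ h ∨ y = h + 2 ∨ y = h + 3) ∨ 4 * i + 2 < x ∧ P.Low h x y)

def Par.SB (P : Par) (h : ℤ) (i : ℕ) (x y : ℤ) : Prop :=
  0 ≤ x ∧ x < P.W ∧ 0 ≤ y ∧ (4 * i + 3 < x ∧ P.Low (h + 3) x y ∨
    x = 4 * i + 3 ∧ (y ≤ h ∨ y = h + 2 ∨ y = h + 3) ∨ x < 4 * i + 3 ∧ P.Low h x y)

/-- While the top of a strip is being flattened. -/
def Par.SF (P : Par) (h : ℤ) (i : ℕ) (x y : ℤ) : Prop :=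
  0 ≤ x ∧ x < P.W ∧ 0 ≤ y ∧ (4 * i + 3 < x ∧ y ≤ h + 6 ∨ x ≤ 4 * i + 3 ∧ P.Low (h + 3) x y)

theorem Par.W_eq (P : Par) : P.W = 4 * P.w + 2 ∧ P.wide = false ∨
    P.W = 4 * P.w + 3 ∧ P.wide = true := by
  unfold Par.W
  cases P.wide <;> simp

theorem Par.gdir_kind0 (P : Par) (j i : ℕ) (c b : Bool) :
    P.gdir (j, 0, i, c, b, 0) = rot j dW := by
  rw [P.gdir_of_lt (by omega)]
  simp only [Par.seg]
  cases P.wide <;> rfl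

theorem Par.gdir_kind1 (P : Par) (j i : ℕ) (c b : Bool) :
    P.gdir (j, 1, i, c, b, 0) = rot j dW := by
  rw [P.gdir_of_lt (by omega)]
  simp only [Par.seg]
  split_ifs <;> rfl

theorem Par.gdir_kind2 (P : Par) (j i : ℕ) (c b : Bool) :
    P.gdir (j, 2, i, c, b, 0) = rot j dS := by
  rw [P.gdir_of_lt (by omega)]
  simp only [Par.seg]
  split_ifs <;> cases P.wide <;> rfl

theorem Par.gdir_kind3 (P : Par) (j i : ℕ) (c b : Bool) :
    P.gdir (j, 3, i, c, b, 0) = rot j dS := by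
  rw [P.gdir_of_lt (by omega)]
  simp only [Par.seg]
  split_ifs <;> rfl

theorem Par.gdir_kind4 (P : Par) (j i : ℕ) (c b : Bool) :
    P.gdir (j, 4, i, c, b, 0) = rot j dW := P.gdir_of_lt (by omega)

theorem Par.gdir_kind5 (P : Par) (j i : ℕ) (c b : Bool) :
    P.gdir (j, 5, i, c, b, 0) = rot j dN := P.gdir_of_lt (by omega)

theorem Par.NegIs.nonneg {P : Par} {s : ℤ} {α : Assembly} {j : ℕ} {z p : Pos} {o : Option Pos}
    (h : P.NegIs s α j z o) (hz : p = z) {u : Pos} (ho : o ≠ some u) {t : Tile}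
    (ht : α (P.emb j p) = some t) : 0 ≤ t.str (rot j u) := by
  subst hz
  obtain ⟨t', h1, h2⟩ := h
  rw [h1] at ht
  obtain rfl := Option.some.inj ht
  exact (h2 u).2 ho

theorem Par.NegIs.exists_neg {P : Par} {s : ℤ} {α : Assembly} {j : ℕ} {z p : Pos}
    {o : Option Pos} (h : P.NegIs s α j z o) (hz : p = z) {u : Pos} (ho : o = some u) :
    ∃ t, α (P.emb j p) = some t ∧ t.str (rot j u) = -s ∧ t.col (rot j u) = 0 := by
  subst hz
  obtain ⟨t', h1, h2⟩ := h
  exact ⟨t', h1, (h2 u).1 ho⟩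

theorem Par.DentA.right {P : Par} {s : ℤ} {α : Assembly} {j : ℕ} {h : ℤ} {m : ℕ} {b : Bool}
    (hd : P.DentA s α j h m b) : ∀ u, (readA b).2 = some u → ∀ t',
      α (P.emb j ((4 * (m : ℤ) + 2, h + 1) + u)) = some t' → 0 ≤ t'.str (rot j (-u)) := by
  intro u hu t' ht'
  cases b
  · obtain rfl : dW = u := Option.some.inj hu
    exact hd.2.nonneg (by ext <;> simp; omega) (by decide) ht'
  · obtain rfl : dS = u := Option.some.inj hu
    exact hd.1.nonneg (by ext <;> simp) (by decide) ht'

theorem Par.DentA.other {P : Par} {s : ℤ} {α : Assembly} {j : ℕ} {h : ℤ} {m : ℕ} {b : Bool}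
    (hd : P.DentA s α j h m b) {L : List Cell} (hL : L.getD 0 (cell dN) = readA (!b)) :
    ∃ u ∈ U2, u ≠ -dS ∧ (L.getD 0 (cell dN)).2 = some u ∧
      ∃ t', α (P.emb j ((4 * (m : ℤ) + 2, h + 1) + u)) = some t' ∧ t'.str (rot j (-u)) = -s ∧
        t'.col (rot j (-u)) = 0 := by
  rw [hL]
  cases b
  · exact ⟨dS, by decide, by decide, rfl, hd.1.exists_neg (by ext <;> simp) (by decide)⟩
  · exact ⟨dW, by decide, by decide, rfl, hd.2.exists_neg (by ext <;> simp; omega) (by decide)⟩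

theorem Par.DentB.right {P : Par} {s : ℤ} {α : Assembly} {j : ℕ} {h : ℤ} {m : ℕ} {b : Bool}
    (hd : P.DentB s α j h m b) : ∀ u, (readB b).2 = some u → ∀ t',
      α (P.emb j ((4 * (m : ℤ) + 3, h + 1) + u)) = some t' → 0 ≤ t'.str (rot j (-u)) := by
  intro u hu t' ht'
  cases b
  · obtain rfl : dE = u := Option.some.inj hu
    exact hd.2.nonneg (by ext <;> simp; omega) (by decide) ht'
  · obtain rfl : dS = u := Option.some.inj hu
    exact hd.1.nonneg (by ext <;> simp) (by decide) ht'

theorem Par.DentB.other {P : Par} {s : ℤ} {α : Assembly} {j : ℕ} {h : ℤ} {m : ℕ} {b : Bool}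
    (hd : P.DentB s α j h m b) {L : List Cell} (hL : L.getD 0 (cell dN) = readB (!b)) :
    ∃ u ∈ U2, u ≠ -dS ∧ (L.getD 0 (cell dN)).2 = some u ∧
      ∃ t', α (P.emb j ((4 * (m : ℤ) + 3, h + 1) + u)) = some t' ∧ t'.str (rot j (-u)) = -s ∧
        t'.col (rot j (-u)) = 0 := by
  rw [hL]
  cases b
  · exact ⟨dS, by decide, by decide, rfl, hd.1.exists_neg (by ext <;> simp) (by decide)⟩
  · exact ⟨dE, by decide, by decide, rfl, hd.2.exists_neg (by ext <;> simp; omega) (by decide)⟩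

theorem Par.NegIs.of_eq {P : Par} {s : ℤ} {α : Assembly} {j : ℕ} {z z' : Pos}
    {o o' : Option Pos} (h : P.NegIs s α j z o) (ho : o = o') (hz : z = z') :
    P.NegIs s α j z' o' := by
  subst hz ho
  exact h

theorem segInc_ok (b v : Bool) : SegOK (segInc b v) dS := by
  revert b v; decide

def qInc (u v : ℤ) : Prop :=
  u = 0 ∧ v = 0 ∨ u = 1 ∧ 0 ≤ v ∧ v ≤ 2 ∨ (u = 2 ∨ u = 3) ∧ 2 ≤ v ∧ v ≤ 4 ∨
    u = 4 ∧ 1 ≤ v ∧ v ≤ 2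

instance (u v : ℤ) : Decidable (qInc u v) := by unfold qInc; infer_instance

theorem mem_offs_segInc (b r : Bool) (u v : ℤ) :
    (u, v) ∈ offs (segInc b r) dS ↔ qInc u v :=
  mem_iff_of_box 0 0 5 5 (by revert b r; decide) (by revert b r; decide)
    (by unfold qInc; omega) u v

theorem Par.St.inc {P : Par} {s : ℤ} {𝒯 : TAS} {j : ℕ} {B : Set Pos} (hC : P.Ctx s 𝒯 j B)
    {α : Assembly} {h : ℤ} {i : ℕ} {c b : Bool} (hi : i + 1 < P.w) (h0 : 0 ≤ h)
    (hh : h + 6 < P.N - P.W)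
    (hS : P.St j B α (P.SA h i) (4 * i + 2) (h + 1) dS (j, 2, i, c, false, 0))
    (hd : P.DentA s α j h i b) :
    ∃ α', Run 𝒯 α α' ∧ P.St j B α' (P.SA h (i + 1)) (4 * ((i + 1 : ℕ) : ℤ) + 2) (h + 1) dS
      (j, 2, i + 1, c && b, false, 0) ∧ P.DentB s α' j (h + 3) i (b ^^ c) := by
  have hW := P.W_eq
  have hL : ∀ b, P.seg j 2 i c b = segInc b (b ^^ c) := fun b => by simp [Par.seg, hi]
  have hn : P.nxt j 2 i c b = (j, 2, i + 1, c && b, false, 0) := by simp [Par.nxt, hi]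
  have hoff : ∀ b r, off (segInc b r) dS (segInc b r).length = (4, 0) := by decide
  have hneed : ∀ b r, ∀ q ∈ needs (segInc b r) dS, qInc q.1 q.2 ∨ q.1 = 1 ∧ q.2 = 3 := by decide
  obtain ⟨α', h1, h2, h3⟩ := hS.seg hC (b := b) (by omega) (by omega) (by simp [guess])
    (by simp [startLab]) (hL b) (segInc_ok _ _) (by rw [hn, P.gdir_kind2]) rfl
    (F := fun u v => qInc u v ∨ u = 1 ∧ v = 3)
    (fun q hq => hneed _ _ q hq)
    (by unfold qInc Par.Rect Par.SA Par.Low; intros; omega)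
    (x' := 4 * ((i + 1 : ℕ) : ℤ) + 2) (y' := h + 1)
    (by rw [hoff]; push_cast; ring) (by rw [hoff]; ring)
    (hS.free hC (by unfold Par.Rect; omega) (by unfold Par.SA Par.Low; omega))
    hd.right (fun _ => hd.other (by rw [hL]; rfl)) (mem_offs_segInc _ _)
    (S' := P.SA h (i + 1)) (by unfold qInc Par.SA Par.Low; intros; omega)
  rw [hn] at h2
  have h4 : ∀ b r, 5 < (segInc b r).length ∧ mark (segInc b r) 3 = sideIf (!r) dN ∧
      off (segInc b r) dS 3 = (1, 2) ∧ mark (segInc b r) 5 = sideIf r dW ∧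
      off (segInc b r) dS 5 = (2, 3) := by decide
  obtain ⟨h5, h6, h7, h8, h9⟩ := h4 b (b ^^ c)
  exact ⟨α', h1, h2, (h3 3 (by omega)).of_eq h6 (by rw [h7]; ext <;> simp <;> ring),
    (h3 5 h5).of_eq h8 (by rw [h9]; ext <;> simp <;> ring)⟩

/-- The displacement of the inner side of a strip from the last column read. -/
def rgt (a : Bool) : ℤ := if a then 4 else 3

theorem Par.rgt_eq (P : Par) : rgt P.wide = P.W - 4 * P.w + 1 := by
  unfold rgt Par.W
  split_ifs <;> ring

def qLast (r u v : ℤ) : Prop :=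
  u = 0 ∧ v = 0 ∨ u = 1 ∧ (0 ≤ v ∧ v ≤ 2 ∨ v = 4 ∨ v = 5) ∨ 2 ≤ u ∧ u ≤ r ∧ 2 ≤ v ∧ v ≤ 7

instance (r u v : ℤ) : Decidable (qLast r u v) := by unfold qLast; infer_instance

theorem segIncLast_ok (a b v : Bool) : SegOK (segIncLast a b v) dS := by
  revert a b v; decide +kernel

theorem mem_offs_segIncLast (a b r : Bool) (u v : ℤ) :
    (u, v) ∈ offs (segIncLast a b r) dS ↔ qLast (rgt a) u v :=
  mem_iff_of_box 0 0 5 8 (by revert a b r; decide +kernel) (by revert a b r; decide +kernel)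
    (by unfold qLast rgt; intros; split_ifs at * <;> omega) u v

theorem Par.St.incLast {P : Par} {s : ℤ} {𝒯 : TAS} {j : ℕ} {B : Set Pos} (hC : P.Ctx s 𝒯 j B)
    {α : Assembly} {h : ℤ} {i : ℕ} {c b : Bool} (hi : i + 1 = P.w) (h0 : 0 ≤ h)
    (hh : h + 9 < P.N - P.W) (hcb : (c && b) = false)
    (hS : P.St j B α (P.SA h i) (4 * i + 2) (h + 1) dS (j, 2, i, c, false, 0))
    (hd : P.DentA s α j h i b) :
    ∃ α', Run 𝒯 α α' ∧ P.St j B α' (P.SB (h + 3) i) (4 * i + 3) (h + 3 + 1) dS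
      (j, 3, i, false, false, 0) ∧ P.DentB s α' j (h + 3) i (b ^^ c) := by
  have hW := P.W_eq
  have hr := P.rgt_eq
  have hL : P.seg j 2 i c b = segIncLast P.wide b (b ^^ c) := by simp [Par.seg, hi, hcb]
  have hL' : (P.seg j 2 i c (!b)).getD 0 (cell dN) = readA (!b) := by
    simp only [Par.seg]
    split_ifs <;> cases P.wide <;> rfl
  have hn : P.nxt j 2 i c b = (j, 3, i, false, false, 0) := by simp [Par.nxt, ← hi, hcb]
  have hoff : ∀ a b r, off (segIncLast a b r) dS (segIncLast a b r).length = (1, 3) := by decide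
  have hneed : ∀ a b r, ∀ q ∈ needs (segIncLast a b r) dS,
      qLast (rgt a) q.1 q.2 ∨ q.1 = 1 ∧ q.2 = 3 := by decide +kernel
  have h4 : ∀ a b r, mark (segIncLast a b r) 0 = (readA b).2 ∧
      (segIncLast a b r).getD 0 (cell dN) = readA b := by decide
  have hS' : ∀ u v, P.SB (h + 3) i u v ↔
      P.SA h i u v ∨ qLast (rgt P.wide) (u - (4 * i + 2)) (v - (h + 1)) := by
    unfold qLast Par.SA Par.SB Par.Low
    intros
    omega
  obtain ⟨α', h1, h2, h3⟩ := hS.seg hC (b := b) (by omega) (by omega) (by simp [guess])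
    (by simp [startLab]) hL (segIncLast_ok _ _ _) (by rw [hn, P.gdir_kind3]) (by rw [(h4 _ _ _).2]; rfl)
    (F := fun u v => qLast (rgt P.wide) u v ∨ u = 1 ∧ v = 3) (hneed _ _ _)
    (by unfold qLast Par.Rect Par.SA Par.Low; intros; omega)
    (x' := 4 * i + 3) (y' := h + 3 + 1)
    (by rw [hoff]; ring) (by rw [hoff]; ring)
    (hS.free hC (by unfold Par.Rect; omega) (by unfold Par.SA Par.Low; omega))
    (by rw [(h4 _ _ _).1]; exact hd.right) (fun _ => by rw [(h4 _ _ _).2]; exact hd.other hL')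
    (mem_offs_segIncLast _ _ _) hS'
  rw [hn] at h2
  have h5 : ∀ a b r, 3 < (segIncLast a b r).length ∧
      mark (segIncLast a b r) 3 = sideIf (!r) dN ∧ off (segIncLast a b r) dS 3 = (1, 2) ∧
      ∃ k < (segIncLast a b r).length, mark (segIncLast a b r) k = sideIf r dW ∧
        off (segIncLast a b r) dS k = (2, 3) := by decide
  obtain ⟨h5, h6, h7, k, h8, h9, h10⟩ := h5 P.wide b (b ^^ c)
  exact ⟨α', h1, h2, (h3 3 h5).of_eq h6 (by rw [h7]; ext <;> simp <;> ring),
    (h3 k h8).of_eq h9 (by rw [h10]; ext <;> simp <;> ring)⟩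

def qOver (r u v : ℤ) : Prop :=
  u = 0 ∧ v = 0 ∨ u = 1 ∧ 0 ≤ v ∧ v ≤ 2 ∨ 2 ≤ u ∧ u ≤ r ∧ 2 ≤ v ∧ v ≤ 5

instance (r u v : ℤ) : Decidable (qOver r u v) := by unfold qOver; infer_instance

theorem segOver_ok (a b v : Bool) : SegOK (segOver a b v) dW := by
  revert a b v; decide +kernel

theorem mem_offs_segOver (a b r : Bool) (u v : ℤ) :
    (u, v) ∈ offs (segOver a b r) dW ↔ qOver (rgt a) u v :=
  mem_iff_of_box 0 0 5 6 (by revert a b r; decide +kernel) (by revert a b r; decide +kernel)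
    (by unfold qOver rgt; intros; split_ifs at * <;> omega) u v

theorem Par.St.over {P : Par} {s : ℤ} {𝒯 : TAS} {j : ℕ} {B : Set Pos} (hC : P.Ctx s 𝒯 j B)
    {α : Assembly} {h : ℤ} {i : ℕ} {c b : Bool} (hi : i + 1 = P.w) (h0 : 0 ≤ h)
    (hh : h + 6 < P.N - P.W) (hcb : (c && b) = true)
    (hS : P.St j B α (P.SA h i) (4 * i + 2) (h + 1) dS (j, 2, i, c, false, 0))
    (hd : P.DentA s α j h i b) :
    ∃ α', Run 𝒯 α α' ∧ P.St j B α' (P.SF h i) (4 * i + 3) (h + 6) dW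
      (j, 4, i, false, false, 0) := by
  have hW := P.W_eq
  have hr := P.rgt_eq
  have hL : P.seg j 2 i c b = segOver P.wide b (b ^^ c) := by simp only [Par.seg, hi, hcb]; simp
  have hL' : (P.seg j 2 i c (!b)).getD 0 (cell dN) = readA (!b) := by
    simp only [Par.seg]
    split_ifs <;> cases P.wide <;> rfl
  have hn : P.nxt j 2 i c b = (j, 4, i, false, false, 0) := by
    simp only [Par.nxt, hcb, ← hi]; simp
  have hoff : ∀ a b r, off (segOver a b r) dW (segOver a b r).length = (1, 5) := by decide
  have hneed : ∀ a b r, ∀ q ∈ needs (segOver a b r) dW,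
      qOver (rgt a) q.1 q.2 ∨ q.1 = 1 ∧ q.2 = 3 := by decide +kernel
  have h4 : ∀ a b r, mark (segOver a b r) 0 = (readA b).2 ∧
      (segOver a b r).getD 0 (cell dN) = readA b := by decide
  have hS' : ∀ u v, P.SF h i u v ↔
      P.SA h i u v ∨ qOver (rgt P.wide) (u - (4 * i + 2)) (v - (h + 1)) := by
    unfold qOver Par.SA Par.SF Par.Low
    intros
    omega
  obtain ⟨α', h1, h2, -⟩ := hS.seg hC (b := b) (by omega) (by omega) (by simp [guess])
    (by simp [startLab]) hL (segOver_ok _ _ _) (by rw [hn, P.gdir_kind4]) (by rw [(h4 _ _ _).2]; rfl)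
    (F := fun u v => qOver (rgt P.wide) u v ∨ u = 1 ∧ v = 3) (hneed _ _ _)
    (by unfold qOver Par.Rect Par.SA Par.Low; intros; omega)
    (x' := 4 * i + 3) (y' := h + 6)
    (by rw [hoff]; ring) (by rw [hoff]; ring)
    (hS.free hC (by unfold Par.Rect; omega) (by unfold Par.SA Par.Low; omega))
    (by rw [(h4 _ _ _).1]; exact hd.right) (fun _ => by rw [(h4 _ _ _).2]; exact hd.other hL')
    (mem_offs_segOver _ _ _) hS'
  rw [hn] at h2
  exact ⟨α', h1, h2⟩

theorem segCopy_ok (b : Bool) : SegOK (segCopy b) dS := by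
  revert b; decide

theorem mem_offs_segCopy (b : Bool) (u v : ℤ) :
    (u, v) ∈ offs (segCopy b) dS ↔ qInc (-u) v :=
  mem_iff_of_box (-4) 0 5 5 (Q := fun u v => qInc (-u) v) (by revert b; decide)
    (by revert b; decide) (by unfold qInc; omega) u v

theorem Par.St.copy {P : Par} {s : ℤ} {𝒯 : TAS} {j : ℕ} {B : Set Pos} (hC : P.Ctx s 𝒯 j B)
    {α : Assembly} {h : ℤ} {i : ℕ} {b : Bool} (hi : i + 1 < P.w) (h0 : 0 ≤ h)
    (hh : h + 6 < P.N - P.W)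
    (hS : P.St j B α (P.SB h (i + 1)) (4 * ((i + 1 : ℕ) : ℤ) + 3) (h + 1) dS
      (j, 3, i + 1, false, false, 0))
    (hd : P.DentB s α j h (i + 1) b) :
    ∃ α', Run 𝒯 α α' ∧ P.St j B α' (P.SB h i) (4 * i + 3) (h + 1) dS
      (j, 3, i, false, false, 0) ∧ P.DentA s α' j (h + 3) (i + 1) b := by
  have hW := P.W_eq
  have hL : ∀ b, P.seg j 3 (i + 1) false b = segCopy b := fun b => by simp [Par.seg]
  have hn : P.nxt j 3 (i + 1) false b = (j, 3, i, false, false, 0) := by simp [Par.nxt]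
  have hoff : ∀ b, off (segCopy b) dS (segCopy b).length = (-4, 0) := by decide
  have hneed : ∀ b, ∀ q ∈ needs (segCopy b) dS, qInc (-q.1) q.2 ∨ q.1 = -1 ∧ q.2 = 3 := by decide
  obtain ⟨α', h1, h2, h3⟩ := hS.seg hC (b := b) (by omega) (by omega) (by simp [guess])
    (by simp [startLab]) (hL b) (segCopy_ok _) (by rw [hn, P.gdir_kind3]) rfl
    (F := fun u v => qInc (-u) v ∨ u = -1 ∧ v = 3) (hneed _)
    (by unfold qInc Par.Rect Par.SB Par.Low; intros; omega)
    (x' := 4 * i + 3) (y' := h + 1)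
    (by rw [hoff]; push_cast; ring) (by rw [hoff]; ring)
    (hS.free hC (by unfold Par.Rect; omega) (by unfold Par.SB Par.Low; omega))
    hd.right (fun _ => hd.other (by rw [hL]; rfl)) (mem_offs_segCopy _)
    (S' := P.SB h i) (by unfold qInc Par.SB Par.Low; intros; omega)
  rw [hn] at h2
  have h4 : ∀ b, 5 < (segCopy b).length ∧ mark (segCopy b) 3 = sideIf (!b) dN ∧
      off (segCopy b) dS 3 = (-1, 2) ∧ mark (segCopy b) 5 = sideIf b dE ∧
      off (segCopy b) dS 5 = (-2, 3) := by decide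
  obtain ⟨h5, h6, h7, h8, h9⟩ := h4 b
  exact ⟨α', h1, h2, (h3 3 (by omega)).of_eq h6 (by rw [h7]; ext <;> simp <;> ring),
    (h3 5 h5).of_eq h8 (by rw [h9]; ext <;> simp <;> ring)⟩

theorem segCopyLast_ok (b : Bool) : SegOK (segCopyLast b) dS := by
  revert b; decide +kernel

theorem mem_offs_segCopyLast (b : Bool) (u v : ℤ) :
    (u, v) ∈ offs (segCopyLast b) dS ↔ qLast 3 (-u) v :=
  mem_iff_of_box (-4) 0 5 8 (Q := fun u v => qLast 3 (-u) v) (by revert b; decide +kernel)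
    (by revert b; decide +kernel) (by unfold qLast; omega) u v

theorem Par.St.copyLast {P : Par} {s : ℤ} {𝒯 : TAS} {j : ℕ} {B : Set Pos} (hC : P.Ctx s 𝒯 j B)
    {α : Assembly} {h : ℤ} {b : Bool} (hw : 0 < P.w) (h0 : 0 ≤ h) (hh : h + 9 < P.N - P.W)
    (hS : P.St j B α (P.SB h 0) (4 * ((0 : ℕ) : ℤ) + 3) (h + 1) dS (j, 3, 0, false, false, 0))
    (hd : P.DentB s α j h 0 b) :
    ∃ α', Run 𝒯 α α' ∧ P.St j B α' (P.SA (h + 3) 0) (4 * ((0 : ℕ) : ℤ) + 2) (h + 3 + 1) dS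
      (j, 2, 0, true, false, 0) ∧ P.DentA s α' j (h + 3) 0 b := by
  have hW := P.W_eq
  have hL : ∀ b, P.seg j 3 0 false b = segCopyLast b := fun b => by simp [Par.seg]
  have hn : P.nxt j 3 0 false b = (j, 2, 0, true, false, 0) := by simp [Par.nxt]
  have hoff : ∀ b, off (segCopyLast b) dS (segCopyLast b).length = (-1, 3) := by decide
  have hneed : ∀ b, ∀ q ∈ needs (segCopyLast b) dS,
      qLast 3 (-q.1) q.2 ∨ q.1 = -1 ∧ q.2 = 3 := by decide +kernel
  obtain ⟨α', h1, h2, h3⟩ := hS.seg hC (b := b) (by omega) (by omega) (by simp [guess])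
    (by simp [startLab]) (hL b) (segCopyLast_ok _) (by rw [hn, P.gdir_kind2]) rfl
    (F := fun u v => qLast 3 (-u) v ∨ u = -1 ∧ v = 3) (hneed _)
    (by unfold qLast Par.Rect Par.SB Par.Low; intros; omega)
    (x' := 4 * ((0 : ℕ) : ℤ) + 2) (y' := h + 3 + 1)
    (by rw [hoff]; simp) (by rw [hoff]; ring)
    (hS.free hC (by unfold Par.Rect; omega) (by unfold Par.SB Par.Low; omega))
    hd.right (fun _ => hd.other (by rw [hL]; rfl)) (mem_offs_segCopyLast _)
    (S' := P.SA (h + 3) 0) (by unfold qLast Par.SA Par.SB Par.Low; intros; omega)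
  rw [hn] at h2
  have h4 : ∀ b, 3 < (segCopyLast b).length ∧ mark (segCopyLast b) 3 = sideIf (!b) dN ∧
      off (segCopyLast b) dS 3 = (-1, 2) ∧
      ∃ k < (segCopyLast b).length, mark (segCopyLast b) k = sideIf b dE ∧
        off (segCopyLast b) dS k = (-2, 3) := by decide
  obtain ⟨h5, h6, h7, k, h8, h9, h10⟩ := h4 b
  exact ⟨α', h1, h2, (h3 3 (by omega)).of_eq h6 (by rw [h7]; ext <;> simp; ring),
    (h3 k h8).of_eq h9 (by rw [h10]; ext <;> simp; ring)⟩

def qFin (u v : ℤ) : Prop :=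
  (u = 0 ∨ u = -1) ∧ -2 ≤ v ∧ v ≤ 0 ∨ (u = -2 ∨ u = -3) ∧ v = 0

instance (u v : ℤ) : Decidable (qFin u v) := by unfold qFin; infer_instance

theorem mem_offs_segFin (dl : Pos) (hdl : dl = dW ∨ dl = dN) (u v : ℤ) :
    (u, v) ∈ offs segFin dl ↔ qFin u v :=
  mem_iff_of_box (-3) (-2) 4 3 (by rcases hdl with rfl | rfl <;> decide)
    (by rcases hdl with rfl | rfl <;> decide) (by unfold qFin; omega) u v

theorem Par.St.fin {P : Par} {s : ℤ} {𝒯 : TAS} {j : ℕ} {B : Set Pos} (hC : P.Ctx s 𝒯 j B)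
    {α : Assembly} {h : ℤ} {i : ℕ} (hi : i + 1 < P.w) (h0 : 0 ≤ h)
    (hh : h + 6 < P.N - P.W)
    (hS : P.St j B α (P.SF h (i + 1)) (4 * ((i + 1 : ℕ) : ℤ) + 3) (h + 6) dW
      (j, 4, i + 1, false, false, 0)) :
    ∃ α', Run 𝒯 α α' ∧ P.St j B α' (P.SF h i) (4 * i + 3) (h + 6) dW
      (j, 4, i, false, false, 0) := by
  have hW := P.W_eq
  have hn : P.nxt j 4 (i + 1) false false = (j, 4, i, false, false, 0) := by simp [Par.nxt]
  have hoff : off segFin dW segFin.length = (-4, 0) := by decide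
  have hneed : ∀ q ∈ needs segFin dW, qFin q.1 q.2 := by decide
  obtain ⟨α', h1, h2, -⟩ := hS.seg hC (b := false) (by omega) (by omega) rfl
    (by simp [startLab]) (L := segFin) rfl (dl := dW) (by decide) (by rw [hn, P.gdir_kind4]) rfl
    (F := qFin) hneed
    (by unfold qFin Par.Rect Par.SF Par.Low; intros; omega)
    (x' := 4 * i + 3) (y' := h + 6)
    (by rw [hoff]; push_cast; ring) (by rw [hoff]; ring)
    (hS.free hC (by unfold Par.Rect; omega) (by unfold Par.SF Par.Low; omega))
    (by intro u hu; cases hu) (by omega) (mem_offs_segFin _ (Or.inl rfl))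
    (S' := P.SF h i) (by unfold qFin Par.SF Par.Low; intros; omega)
  rw [hn] at h2
  exact ⟨α', h1, h2⟩

/-- A strip grown to full width up to height `h`. -/
def Par.Flat (P : Par) (h x y : ℤ) : Prop := 0 ≤ x ∧ x < P.W ∧ 0 ≤ y ∧ y ≤ h

theorem Par.St.finLast {P : Par} {s : ℤ} {𝒯 : TAS} {j : ℕ} {B : Set Pos} (hC : P.Ctx s 𝒯 j B)
    {α : Assembly} {h : ℤ} (hw : 0 < P.w) (h0 : 0 ≤ h) (hh : h + 6 < P.N - P.W)
    (hS : P.St j B α (P.SF h 0) (4 * ((0 : ℕ) : ℤ) + 3) (h + 6) dW (j, 4, 0, false, false, 0))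
    {l : Label} (hn : P.nxt j 4 0 false false = l) (hdl : P.gdir l = rot j dN)
    (hend : α (P.emb j (0, h + 7)) = none) :
    ∃ α', Run 𝒯 α α' ∧ P.St j B α' (P.Flat (h + 6)) 0 (h + 7) dN l := by
  have hW := P.W_eq
  have hoff : off segFin dN segFin.length = (-3, 1) := by decide
  have hneed : ∀ q ∈ needs segFin dN, qFin q.1 q.2 := by decide
  obtain ⟨α', h1, h2, -⟩ := hS.seg hC (b := false) (by omega) (by omega) rfl
    (by simp [startLab]) (L := segFin) rfl (dl := dN) (by decide) (by rw [hn, hdl]) rfl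
    (F := qFin) hneed
    (by unfold qFin Par.Rect Par.SF Par.Low; intros; omega)
    (x' := 0) (y' := h + 7)
    (by rw [hoff]; simp) (by rw [hoff]; ring) hend
    (by intro u hu; cases hu) (by omega) (mem_offs_segFin _ (Or.inr rfl))
    (S' := P.Flat (h + 6)) (by unfold qFin Par.SF Par.Low Par.Flat; intros; omega)
  rw [hn] at h2
  exact ⟨α', h1, h2⟩

/-- The profile while the initial bits are being written. -/
def Par.SI (P : Par) (i : ℕ) (x y : ℤ) : Prop :=
  4 * i + 3 < x ∧ x < P.W ∧ 0 ≤ y ∧ P.Low 0 x y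

def qInit (u v : ℤ) : Prop :=
  (u = 0 ∨ u = -1) ∧ v = 0 ∨ (u = -2 ∨ u = -3) ∧ 0 ≤ v ∧ v ≤ 2

instance (u v : ℤ) : Decidable (qInit u v) := by unfold qInit; infer_instance

theorem segInit_ok (b : Bool) : SegOK (segInit b) dW := by
  revert b; decide

theorem mem_offs_segInit (b : Bool) (u v : ℤ) :
    (u, v) ∈ offs (segInit b) dW ↔ qInit u v :=
  mem_iff_of_box (-3) 0 4 3 (by revert b; decide) (by revert b; decide)
    (by unfold qInit; omega) u v

theorem Par.St.init {P : Par} {s : ℤ} {𝒯 : TAS} {j : ℕ} {B : Set Pos} (hC : P.Ctx s 𝒯 j B)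
    {α : Assembly} {i : ℕ} (hi : i + 1 < P.w) (hh : 6 < P.N - P.W)
    (hS : P.St j B α (P.SI (i + 1)) (4 * ((i + 1 : ℕ) : ℤ) + 3) 0 dW
      (j, 1, i + 1, false, false, 0)) :
    ∃ α', Run 𝒯 α α' ∧ P.St j B α' (P.SI i) (4 * i + 3) 0 dW (j, 1, i, false, false, 0) ∧
      P.DentA s α' j 0 (i + 1) (P.bits j (i + 1)) := by
  have hW := P.W_eq
  set b := P.bits j (i + 1) with hb
  have hL : P.seg j 1 (i + 1) false false = segInit b := by simp [Par.seg, hb]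
  have hn : P.nxt j 1 (i + 1) false false = (j, 1, i, false, false, 0) := by simp [Par.nxt]
  have hoff : ∀ b, off (segInit b) dW (segInit b).length = (-4, 0) := by decide
  have hneed : ∀ b, ∀ q ∈ needs (segInit b) dW, qInit q.1 q.2 ∨ q.1 = -1 ∧ q.2 = 1 := by decide
  obtain ⟨α', h1, h2, h3⟩ := hS.seg hC (b := false) (by omega) (by omega) rfl
    (by simp [startLab]) hL (segInit_ok _) (by rw [hn, P.gdir_kind1]) rfl
    (F := fun u v => qInit u v ∨ u = -1 ∧ v = 1) (hneed _)
    (by unfold qInit Par.Rect Par.SI Par.Low; intros; omega)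
    (x' := 4 * i + 3) (y' := 0)
    (by rw [hoff]; push_cast; ring) (by rw [hoff]; rfl)
    (hS.free hC (by unfold Par.Rect; omega) (by unfold Par.SI Par.Low; omega))
    (by intro u hu; cases hu) (by omega) (mem_offs_segInit _)
    (S' := P.SI i) (by unfold qInit Par.SI Par.Low; intros; omega)
  rw [hn] at h2
  have h4 : ∀ b, 3 < (segInit b).length ∧ mark (segInit b) 1 = sideIf (!b) dN ∧
      off (segInit b) dW 1 = (-1, 0) ∧ mark (segInit b) 3 = sideIf b dE ∧
      off (segInit b) dW 3 = (-2, 1) := by decide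
  obtain ⟨h5, h6, h7, h8, h9⟩ := h4 b
  exact ⟨α', h1, h2, (h3 1 (by omega)).of_eq h6 (by rw [h7]; ext <;> simp; ring),
    (h3 3 h5).of_eq h8 (by rw [h9]; ext <;> simp; ring)⟩

def qInitLast (u v : ℤ) : Prop :=
  u = 0 ∧ v = 0 ∨ u = -1 ∧ (v = 0 ∨ v = 2 ∨ v = 3) ∨ (u = -2 ∨ u = -3) ∧ 0 ≤ v ∧ v ≤ 5

instance (u v : ℤ) : Decidable (qInitLast u v) := by unfold qInitLast; infer_instance

theorem segInitLast_ok (b : Bool) : SegOK (segInitLast b) dS := by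
  revert b; decide +kernel

theorem mem_offs_segInitLast (b : Bool) (u v : ℤ) :
    (u, v) ∈ offs (segInitLast b) dS ↔ qInitLast u v :=
  mem_iff_of_box (-3) 0 4 6 (by revert b; decide +kernel) (by revert b; decide +kernel)
    (by unfold qInitLast; omega) u v

theorem Par.St.initLast {P : Par} {s : ℤ} {𝒯 : TAS} {j : ℕ} {B : Set Pos} (hC : P.Ctx s 𝒯 j B)
    {α : Assembly} (hw : 0 < P.w) (hh : 6 < P.N - P.W)
    (hS : P.St j B α (P.SI 0) (4 * ((0 : ℕ) : ℤ) + 3) 0 dW (j, 1, 0, false, false, 0)) :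
    ∃ α', Run 𝒯 α α' ∧ P.St j B α' (P.SA 0 0) (4 * ((0 : ℕ) : ℤ) + 2) (0 + 1) dS
      (j, 2, 0, true, false, 0) ∧ P.DentA s α' j 0 0 (P.bits j 0) := by
  have hW := P.W_eq
  set b := P.bits j 0 with hb
  have hL : P.seg j 1 0 false false = segInitLast b := by simp [Par.seg, hb]
  have hn : P.nxt j 1 0 false false = (j, 2, 0, true, false, 0) := by simp [Par.nxt]
  have hoff : ∀ b, off (segInitLast b) dS (segInitLast b).length = (-1, 1) := by decide
  have hneed : ∀ b, ∀ q ∈ needs (segInitLast b) dS,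
      qInitLast q.1 q.2 ∨ q.1 = -1 ∧ q.2 = 1 := by decide +kernel
  obtain ⟨α', h1, h2, h3⟩ := hS.seg hC (b := false) (by omega) (by omega) rfl
    (by simp [startLab]) hL (segInitLast_ok _) (by rw [hn, P.gdir_kind2]) rfl
    (F := fun u v => qInitLast u v ∨ u = -1 ∧ v = 1) (hneed _)
    (by unfold qInitLast Par.Rect Par.SI Par.Low; intros; omega)
    (x' := 4 * ((0 : ℕ) : ℤ) + 2) (y' := 0 + 1)
    (by rw [hoff]; simp) (by rw [hoff])
    (hS.free hC (by unfold Par.Rect; omega) (by unfold Par.SI Par.Low; omega))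
    (by intro u hu; cases hu) (by omega) (mem_offs_segInitLast _)
    (S' := P.SA 0 0) (by unfold qInitLast Par.SA Par.SI Par.Low; intros; omega)
  rw [hn] at h2
  have h4 : ∀ b, 1 < (segInitLast b).length ∧ mark (segInitLast b) 1 = sideIf (!b) dN ∧
      off (segInitLast b) dS 1 = (-1, 0) ∧
      ∃ k < (segInitLast b).length, mark (segInitLast b) k = sideIf b dE ∧
        off (segInitLast b) dS k = (-2, 1) := by decide
  obtain ⟨h5, h6, h7, k, h8, h9, h10⟩ := h4 b
  exact ⟨α', h1, h2, (h3 1 h5).of_eq h6 (by rw [h7]; ext <;> simp),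
    (h3 k h8).of_eq h9 (by rw [h10]; ext <;> simp)⟩

def qStart (r u v : ℤ) : Prop := 2 - r ≤ u ∧ u ≤ 0 ∧ 0 ≤ v ∧ v ≤ 2

instance (r u v : ℤ) : Decidable (qStart r u v) := by unfold qStart; infer_instance

theorem segStart_ok (a : Bool) : SegOK (segStart a) dW := by
  revert a; decide

theorem mem_offs_segStart (a : Bool) (u v : ℤ) :
    (u, v) ∈ offs (segStart a) dW ↔ qStart (rgt a) u v :=
  mem_iff_of_box (-2) 0 3 3 (by revert a; decide) (by revert a; decide)
    (by unfold qStart rgt; intros; split_ifs at * <;> omega) u v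

theorem off_segStart_length (a : Bool) :
    off (segStart a) dW (segStart a).length = (1 - rgt a, 0) := by
  revert a; decide

theorem mark_segStart (a : Bool) (m : ℕ) : mark (segStart a) m = none := by
  have h : ∀ a, ∀ m < 9, mark (segStart a) m = none := by decide
  rcases Nat.lt_or_ge m 9 with hm | hm
  · exact h a m hm
  · unfold mark
    rw [List.getD_eq_default]
    · rfl
    · cases a
      · exact le_trans (by decide) hm
      · exact le_trans (by decide) hm

theorem Par.St.start {P : Par} {s : ℤ} {𝒯 : TAS} {j : ℕ} {B : Set Pos} (hC : P.Ctx s 𝒯 j B)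
    {α : Assembly} (hj : 0 < j) (hw : 0 < P.w) (hh : 6 < P.N - P.W)
    (hS : P.St j B α (fun _ _ => False) (P.W - 1) 0 dW (j, 0, 0, false, false, 0)) :
    ∃ α', Run 𝒯 α α' ∧ P.St j B α' (P.SI (P.w - 1)) (4 * ((P.w - 1 : ℕ) : ℤ) + 3) 0 dW
      (j, 1, P.w - 1, false, false, 0) := by
  have hW := P.W_eq
  have hr := P.rgt_eq
  have hn : P.nxt j 0 0 false false = (j, 1, P.w - 1, false, false, 0) := rfl
  have hneed : ∀ a, ∀ q ∈ needs (segStart a) dW, qStart (rgt a) q.1 q.2 := by decide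
  obtain ⟨α', h1, h2, -⟩ := hS.seg hC (b := false) (by omega) (by omega) rfl
    (by simp [startLab]; omega) (L := segStart P.wide) rfl (segStart_ok _)
    (by rw [hn, P.gdir_kind1]) (by cases P.wide <;> rfl)
    (F := qStart (rgt P.wide)) (hneed _)
    (fun u v h => ⟨by unfold qStart at h; unfold Par.Rect; omega, fun h' => h'⟩)
    (x' := 4 * ((P.w - 1 : ℕ) : ℤ) + 3) (y' := 0)
    (by rw [off_segStart_length]; simp only; omega) (by rw [off_segStart_length]; rfl)
    (hS.free hC (by unfold Par.Rect; omega) (by simp))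
    (by rw [mark_segStart]; intro u hu; cases hu) (by omega) (mem_offs_segStart _)
    (S' := P.SI (P.w - 1)) (by
      intro u v
      rw [false_or]
      unfold qStart Par.SI Par.Low
      omega)
  rw [hn] at h2
  exact ⟨α', h1, h2⟩

theorem Par.emb_zero_corner (P : Par) : P.emb 0 (P.W - 1, 0) = (0, 0) := by
  simp [Par.emb, rot, Par.corner]

/-- Growth of the first strip starts at the seed. -/
theorem Par.St.start_seed {P : Par} {s : ℤ} {𝒯 : TAS} (hC : P.Ctx s 𝒯 0 ∅)
    (hseed : 𝒯.seedTile = P.pathTile s 0 0 0 false false 0) (hw : 0 < P.w) :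
    ∃ α', Run 𝒯 𝒯.seed α' ∧ P.St 0 ∅ α' (P.SI (P.w - 1)) (4 * ((P.w - 1 : ℕ) : ℤ) + 3) 0 dW
      (0, 1, P.w - 1, false, false, 0) := by
  have hW := P.W_eq
  have hr := P.rgt_eq
  have hn : P.nxt 0 0 0 false false = (0, 1, P.w - 1, false, false, 0) := rfl
  have hs := hC.sys.pos
  set d := (dirs (segStart P.wide) dW).getD 1 0 with hd
  have hd' : d = dN ∨ d = dW := by rw [hd]; cases P.wide <;> decide
  have hL : P.seg 0 0 0 false false = segStart P.wide := rfl
  have hlen : 6 ≤ (segStart P.wide).length := by cases P.wide <;> decide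
  have hlab : P.outLab 0 0 0 false false 0 = (0, 0, 0, false, false, 1) := by
    unfold Par.outLab
    rw [hL, if_pos (by omega)]
  have hgd : P.gdir (0, 0, 0, false, false, 1) = d := by
    rw [P.gdir_of_lt (by omega), hL, hd, dirs_getD _ _ (by omega)]
    rfl
  have hlab0 : Par.inLab 0 0 0 false false 0 = startLab := rfl
  have hglue : ∀ u, P.glue (Par.inLab 0 0 0 false false 0) (P.outLab 0 0 0 false false 0) u =
      if u = d then some (code (0, 0, 0, false, false, 1)) else none := by
    intro u
    unfold Par.glue
    rw [hlab, hlab0, hgd]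
    simp
  have hmk : ((P.seg 0 0 0 false false).getD 0 (cell dN)).2.map (rot 0) = none := by
    rw [hL]
    exact congrArg (Option.map (rot 0)) (mark_segStart P.wide 0)
  have hcol : 𝒯.seedTile.str d = 1 ∧ 𝒯.seedTile.col d = code (0, 0, 0, false, false, 1) := by
    rw [hseed]
    exact mkTile_of_ne (by rw [hmk]; simp) (by rw [hglue, if_pos rfl])
  have hne : ∀ p, p ≠ (0, 0) → 𝒯.seed p = none := fun p hp => by simp [TAS.seed, hp]
  have hneL : ∀ m, 0 < m → m ≤ (segStart P.wide).length →
      𝒯.seed (P.emb 0 ((P.W - 1, 0) + off (segStart P.wide) dW m)) = none := by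
    intro m h0 hm
    refine hne _ ?_
    rw [← P.emb_zero_corner]
    intro h
    have := P.emb_injective _ h
    have h2 : off (segStart P.wide) dW m = off (segStart P.wide) dW 0 := by
      rw [off_zero]
      exact add_eq_left.1 this
    exact (segStart_ok P.wide).2.2.2.1 m hm 0 h0 h2.symm
  obtain ⟨α', h1, h2⟩ := P.seg_run hC.sys (α := 𝒯.seed) (j := 0) (kind := 0) (i := 0)
    (c := false) (b := false) (by omega) (by omega) hw rfl hL (z := (P.W - 1, 0))
    (segStart_ok P.wide) (by rw [hn, P.gdir_kind1]) 1 (by omega) (by omega)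
    (by
      have ho : off (segStart P.wide) dW 1 = d := by
        rw [off_succ _ _ (by omega), off_zero, zero_add]
      rw [ho, P.emb_add, P.emb_zero_corner, ← hd]
      have hr0 : rot 0 d = d := rfl
      have hz : ((0, 0) : Pos) + d = d := by ext <;> simp
      rw [hr0, hz]
      refine ⟨by rcases hd' with h | h <;> rw [h] <;> decide, hne _ ?_, ?_, 𝒯.seedTile, ?_,
        hcol.1, hcol.2⟩
      · rcases hd' with h | h <;> rw [h] <;> decide
      · intro m u t' hu hm ht' hpos
        by_cases hmu : m + u = (0, 0)
        · rw [hmu] at ht'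
          simp only [TAS.seed, if_true, Option.some.injEq] at ht'
          subst ht'
          rw [hseed] at hpos ⊢
          have := mkTile_pos hs hpos
          rw [hglue] at this
          split_ifs at this with hc
          refine ⟨?_, by rw [← hc, neg_neg], (Option.some.inj this).symm⟩
          rw [← hc]
          exact eq_neg_of_add_eq_zero_left hmu
        · rw [hne _ hmu] at ht'
          simp at ht'
      · rw [sub_self]
        exact if_pos rfl)
    (fun m h1 h2 => hneL m (by omega) h2)
    (fun m _ _ u hu => by rw [mark_segStart] at hu; simp at hu)
    (fun u hu => by rw [mark_segStart] at hu; simp at hu) (by omega)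
  refine ⟨α', h1.run, ⟨?_, ?_⟩⟩
  · rw [h1.dom, Set.empty_union]
    have hdom : adom 𝒯.seed = P.emb 0 '' {(P.W - 1, 0)} := by
      rw [Set.image_singleton, P.emb_zero_corner]
      ext p
      simp [adom, TAS.seed]
    rw [hdom, ← Set.image_union]
    congr 1
    ext ⟨u, v⟩
    have h3 : P.SI (P.w - 1) u v ↔ (u - (P.W - 1), v - 0) ∈ offs (segStart P.wide) dW := by
      rw [mem_offs_segStart]
      unfold qStart Par.SI Par.Low
      omega
    simp only [Set.mem_union, Set.mem_singleton_iff, Set.mem_ofPred_eq, h3, mem_offs]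
    constructor
    · rintro (h | ⟨m, -, hm, e⟩)
      · refine ⟨0, by omega, ?_⟩
        rw [off_zero, (Prod.mk.inj h).1, (Prod.mk.inj h).2, sub_self, sub_self]
        rfl
      · exact ⟨m, hm, by
          have := congrArg (· - ((P.W - 1, 0) : Pos)) e
          simpa using this.symm⟩
    · rintro ⟨m, hm, e⟩
      rcases Nat.eq_zero_or_pos m with rfl | h0
      · left
        rw [off_zero] at e
        have h4 := (Prod.mk.inj e)
        ext
        · have := h4.1; simp only; omega
        · have := h4.2; simp only; omega
      · exact Or.inr ⟨m, h0, hm, by rw [e]; ext <;> simp⟩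
  · rw [off_segStart_length, hn] at h2
    have : ((P.W - 1, 0) : Pos) + (1 - rgt P.wide, 0) = (4 * ((P.w - 1 : ℕ) : ℤ) + 3, 0) := by
      ext
      · simp only [Prod.mk_add_mk]; omega
      · simp
    rw [this] at h2
    exact h2

/-- The carry into bit `i` when `n` is incremented. -/
def carry (n i : ℕ) : Bool := decide (n % 2 ^ i = 2 ^ i - 1)

theorem carry_zero (n : ℕ) : carry n 0 = true := by simp [carry, Nat.mod_one]

theorem mod_two_pow_succ' (n i : ℕ) :
    n % 2 ^ (i + 1) = n % 2 ^ i + 2 ^ i * (n.testBit i).toNat := by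
  rw [Nat.toNat_testBit, pow_succ, Nat.mod_mul]

theorem carry_succ (n i : ℕ) : carry n (i + 1) = (carry n i && n.testBit i) := by
  have h := mod_two_pow_succ' n i
  have h1 := Nat.mod_lt n (Nat.two_pow_pos i)
  unfold carry
  rw [Bool.eq_iff_iff, Bool.and_eq_true, decide_eq_true_iff, decide_eq_true_iff, h, pow_succ]
  cases n.testBit i
  · simp only [Bool.toNat_false, Bool.false_eq_true, and_false, iff_false]
    omega
  · simp only [Bool.toNat_true, and_true]
    omega

theorem succ_mod_two_pow (n i : ℕ) :
    (n + 1) % 2 ^ i = if carry n i then 0 else n % 2 ^ i + 1 := by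
  have h1 := Nat.mod_lt n (Nat.two_pow_pos i)
  have h2 : (n + 1) % 2 ^ i = (n % 2 ^ i + 1) % 2 ^ i := by simp
  rw [h2]
  unfold carry
  split_ifs with h
  · rw [decide_eq_true_iff] at h
    have : n % 2 ^ i + 1 = 2 ^ i := by omega
    rw [this, Nat.mod_self]
  · rw [decide_eq_true_iff] at h
    exact Nat.mod_eq_of_lt (by omega)

theorem testBit_succ (n i : ℕ) : (n + 1).testBit i = (n.testBit i ^^ carry n i) := by
  have h1 := mod_two_pow_succ' n i
  have h2 := mod_two_pow_succ' (n + 1) i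
  have h3 := succ_mod_two_pow n i
  have h4 := succ_mod_two_pow n (i + 1)
  have h5 := carry_succ n i
  have h6 := Nat.two_pow_pos i
  have h7 : carry n i = true → n % 2 ^ i = 2 ^ i - 1 := by simp [carry]
  cases hc : carry n i <;> cases hb : n.testBit i <;> cases hb' : (n + 1).testBit i <;>
    simp [hc, hb, hb'] at h1 h2 h3 h4 h5 h7 ⊢ <;> simp [h5] at h4 <;> omega

theorem carry_eq_true_iff {n w : ℕ} (h : n < 2 ^ w) : carry n w = true ↔ n + 1 = 2 ^ w := by
  unfold carry
  rw [decide_eq_true_iff, Nat.mod_eq_of_lt h]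
  omega

section Rows

variable {P : Par} {s : ℤ} {𝒯 : TAS} {j : ℕ} {B : Set Pos}

/-- All bits of `n` are incremented except the last one. -/
theorem Par.St.incAll (hC : P.Ctx s 𝒯 j B) {h : ℤ} {n : ℕ} {α : Assembly} (h0 : 0 ≤ h)
    (hh : h + 6 < P.N - P.W)
    (hS : P.St j B α (P.SA h 0) (4 * ((0 : ℕ) : ℤ) + 2) (h + 1) dS (j, 2, 0, true, false, 0))
    (hd : ∀ m < P.w, P.DentA s α j h m (n.testBit m)) {i : ℕ} (hi : i < P.w) :
    ∃ α', Run 𝒯 α α' ∧ P.St j B α' (P.SA h i) (4 * i + 2) (h + 1) dS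
      (j, 2, i, carry n i, false, 0) ∧
      (∀ m < i, P.DentB s α' j (h + 3) m ((n + 1).testBit m)) := by
  induction i with
  | zero => exact ⟨α, Relation.ReflTransGen.refl, by rw [carry_zero]; exact hS, by simp⟩
  | succ i ih =>
    obtain ⟨α', h1, h2, h3⟩ := ih (by omega)
    obtain ⟨α'', h4, h5, h6⟩ := h2.inc hC hi h0 hh
      ((hd i (by omega)).extends (extends_of_run h1))
    refine ⟨α'', h1.trans h4, by rw [carry_succ]; exact h5, fun m hm => ?_⟩
    rcases Nat.lt_succ_iff_lt_or_eq.1 hm with hm | rfl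
    · exact (h3 m hm).extends (extends_of_run h4)
    · rw [testBit_succ]; exact h6

/-- All bits are copied upwards. -/
theorem Par.St.copyAll (hC : P.Ctx s 𝒯 j B) {h : ℤ} {n i : ℕ} (h0 : 0 ≤ h)
    (hh : h + 9 < P.N - P.W) (hi : i < P.w) {α : Assembly}
    (hS : P.St j B α (P.SB h i) (4 * i + 3) (h + 1) dS (j, 3, i, false, false, 0))
    (hd : ∀ m ≤ i, P.DentB s α j h m (n.testBit m))
    (hd' : ∀ m < P.w, i < m → P.DentA s α j (h + 3) m (n.testBit m)) :
    ∃ α', Run 𝒯 α α' ∧ P.St j B α' (P.SA (h + 3) 0) (4 * ((0 : ℕ) : ℤ) + 2) (h + 3 + 1) dS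
      (j, 2, 0, true, false, 0) ∧ ∀ m < P.w, P.DentA s α' j (h + 3) m (n.testBit m) := by
  induction i generalizing α with
  | zero =>
    obtain ⟨α', h1, h2, h3⟩ := hS.copyLast hC hi h0 hh (hd 0 le_rfl)
    refine ⟨α', h1, h2, fun m hm => ?_⟩
    rcases Nat.eq_zero_or_pos m with rfl | hm'
    · exact h3
    · exact (hd' m hm hm').extends (extends_of_run h1)
  | succ i ih =>
    obtain ⟨α', h1, h2, h3⟩ := hS.copy hC hi h0 (by omega) (hd (i + 1) le_rfl)
    have he := extends_of_run h1
    obtain ⟨α'', h4, h5⟩ := ih (by omega) h2 (fun m hm => (hd m (by omega)).extends he)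
      (fun m hm hm' => by
        rcases Nat.lt_or_eq_of_le hm' with hm' | rfl
        · exact (hd' m hm hm').extends he
        · exact h3)
    exact ⟨α'', h1.trans h4, h5⟩

/-- All initial bits are written. -/
theorem Par.St.initAll (hC : P.Ctx s 𝒯 j B) {i : ℕ} (hh : 6 < P.N - P.W) (hi : i < P.w)
    {α : Assembly}
    (hS : P.St j B α (P.SI i) (4 * i + 3) 0 dW (j, 1, i, false, false, 0))
    (hd : ∀ m < P.w, i < m → P.DentA s α j 0 m (P.bits j m)) :
    ∃ α', Run 𝒯 α α' ∧ P.St j B α' (P.SA 0 0) (4 * ((0 : ℕ) : ℤ) + 2) (0 + 1) dS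
      (j, 2, 0, true, false, 0) ∧ ∀ m < P.w, P.DentA s α' j 0 m (P.bits j m) := by
  induction i generalizing α with
  | zero =>
    obtain ⟨α', h1, h2, h3⟩ := hS.initLast hC hi hh
    refine ⟨α', h1, h2, fun m hm => ?_⟩
    rcases Nat.eq_zero_or_pos m with rfl | hm'
    · exact h3
    · exact (hd m hm hm').extends (extends_of_run h1)
  | succ i ih =>
    obtain ⟨α', h1, h2, h3⟩ := hS.init hC hi hh
    obtain ⟨α'', h4, h5⟩ := ih (by omega) h2 (fun m hm hm' => by
        rcases Nat.lt_or_eq_of_le hm' with hm' | rfl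
        · exact (hd m hm hm').extends (extends_of_run h1)
        · exact h3)
    exact ⟨α'', h1.trans h4, h5⟩

/-- The top of a strip is flattened. -/
theorem Par.St.finAll (hC : P.Ctx s 𝒯 j B) {h : ℤ} {i : ℕ} (h0 : 0 ≤ h)
    (hh : h + 6 < P.N - P.W) (hi : i < P.w) {α : Assembly}
    (hS : P.St j B α (P.SF h i) (4 * i + 3) (h + 6) dW (j, 4, i, false, false, 0))
    {l : Label} (hn : P.nxt j 4 0 false false = l) (hdl : P.gdir l = rot j dN)
    (hend : P.emb j (0, h + 7) ∉ B) :
    ∃ α', Run 𝒯 α α' ∧ P.St j B α' (P.Flat (h + 6)) 0 (h + 7) dN l := by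
  induction i generalizing α with
  | zero =>
    refine hS.finLast hC hi h0 hh hn hdl (eq_none_of_notMem_adom ?_)
    rw [hS.dom]
    rintro (h | ⟨p, hp, e⟩)
    · exact hend h
    · rw [P.emb_injective j e] at hp
      simp only [Set.mem_ofPred_eq, Par.SF, Par.Low] at hp
      omega
  | succ i ih =>
    obtain ⟨α', h1, h2⟩ := hS.fin hC hi h0 hh
    obtain ⟨α'', h4, h5⟩ := ih (by omega) h2
    exact ⟨α'', h1.trans h4, h5⟩

/-- The remaining `r` cycles of a counter. -/
theorem Par.St.count (hC : P.Ctx s 𝒯 j B) {h : ℤ} {n r : ℕ} (h0 : 0 ≤ h) (hr : 0 < r)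
    (hn2 : n + r = 2 ^ P.w) (hh : h + 6 * r < P.N - P.W) (hw : 0 < P.w) {α : Assembly}
    (hS : P.St j B α (P.SA h 0) (4 * ((0 : ℕ) : ℤ) + 2) (h + 1) dS (j, 2, 0, true, false, 0))
    (hd : ∀ m < P.w, P.DentA s α j h m (n.testBit m))
    {l : Label} (hn : P.nxt j 4 0 false false = l) (hdl : P.gdir l = rot j dN)
    (hend : P.emb j (0, h + 6 * r + 1) ∉ B) :
    ∃ α', Run 𝒯 α α' ∧ P.St j B α' (P.Flat (h + 6 * r)) 0 (h + 6 * r + 1) dN l := by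
  induction r, hr using Nat.le_induction generalizing h n α with
  | base =>
    obtain ⟨α', h1, h2, -⟩ := hS.incAll hC h0 (by omega) hd (i := P.w - 1) (by omega)
    have hc : (carry n (P.w - 1) && n.testBit (P.w - 1)) = true := by
      rw [← carry_succ, Nat.sub_add_cancel hw, carry_eq_true_iff (by omega)]
      omega
    obtain ⟨α'', h3, h4⟩ := h2.over hC (by omega) h0 (by omega) hc
      ((hd _ (by omega)).extends (extends_of_run h1))
    obtain ⟨α₃, h5, h6⟩ := h4.finAll hC h0 (by omega) (by omega) hn hdl (by
      convert hend using 3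
      push_cast
      ring_nf)
    refine ⟨α₃, h1.trans (h3.trans h5), ?_⟩
    convert h6 using 1 <;> push_cast <;> ring_nf
  | succ r hr ih =>
    obtain ⟨α', h1, h2, h3⟩ := hS.incAll hC h0 (by omega) hd (i := P.w - 1) (by omega)
    have hc : (carry n (P.w - 1) && n.testBit (P.w - 1)) = false := by
      rw [← carry_succ, Nat.sub_add_cancel hw, ← Bool.not_eq_true,
        carry_eq_true_iff (by omega)]
      omega
    obtain ⟨α'', h4, h5, h6⟩ := h2.incLast hC (by omega) h0 (by omega) hc
      ((hd _ (by omega)).extends (extends_of_run h1))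
    obtain ⟨α₃, h7, h8, h9⟩ := h5.copyAll hC (n := n + 1) (by omega) (by omega) (by omega)
      (fun m hm => by
        rcases Nat.lt_or_eq_of_le hm with hm | rfl
        · exact (h3 m hm).extends (extends_of_run h4)
        · rw [testBit_succ]; exact h6)
      (fun m hm hm' => by omega)
    have e : h + 3 + 3 = h + 6 := by ring
    rw [e] at h8 h9
    have e2 : h + 6 + 6 * (r : ℤ) = h + 6 * ((r + 1 : ℕ) : ℤ) := by push_cast; ring
    obtain ⟨α₄, h10, h11⟩ := ih (by omega) (by omega) (by omega) h8 h9 (by rw [e2]; exact hend)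
    rw [e2] at h11
    exact ⟨α₄, h1.trans (h4.trans (h7.trans h10)), h11⟩

/-- A whole strip. -/
theorem Par.St.strip (hC : P.Ctx s 𝒯 j B) {n r : ℕ} (hr : 0 < r)
    (hn2 : n + r = 2 ^ P.w) (hh : 6 * r < P.N - P.W) (hw : 0 < P.w)
    (hbits : ∀ m, P.bits j m = n.testBit m) {α : Assembly}
    (hS : P.St j B α (P.SI (P.w - 1)) (4 * ((P.w - 1 : ℕ) : ℤ) + 3) 0 dW
      (j, 1, P.w - 1, false, false, 0))
    {l : Label} (hn : P.nxt j 4 0 false false = l) (hdl : P.gdir l = rot j dN)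
    (hend : P.emb j (0, 6 * r + 1) ∉ B) :
    ∃ α', Run 𝒯 α α' ∧ P.St j B α' (P.Flat (6 * r)) 0 (6 * r + 1) dN l := by
  have hh' : 6 < P.N - P.W ∨ 6 * (r : ℤ) < 6 := by omega
  obtain ⟨α', h1, h2, h3⟩ := hS.initAll hC (by omega) (by omega) (fun m hm hm' => by omega)
  obtain ⟨α'', h4, h5⟩ := h2.count hC (n := n) (r := r) le_rfl hr hn2 (by omega) hw
    (fun m hm => by rw [← hbits]; exact h3 m hm) hn hdl (by rw [zero_add]; exact hend)
  rw [zero_add] at h5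
  exact ⟨α'', h1.trans h4, h5⟩

/-- One cell of the tail. -/
theorem Par.St.tail (hC : P.Ctx s 𝒯 j B) {α : Assembly} {S S' : ℤ → ℤ → Prop} {y : ℤ} {i : ℕ}
    (hi : i < P.w) (hS : P.St j B α S 0 y dN (j, 5, i, false, false, 0))
    (hr : P.Rect 0 y) (hn : ¬ S 0 y) {l : Label} (hl : P.nxt j 5 i false false = l) {dl : Pos}
    (hdl : dl = dN ∨ dl = dE) (hg : P.gdir l = rot j dl)
    (hend : α (P.emb j ((0, y) + dl)) = none)
    (hS' : ∀ u v, S' u v ↔ S u v ∨ u = 0 ∧ v = y) :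
    ∃ α', Run 𝒯 α α' ∧ P.St j B α' S' (0 + dl.1) (y + dl.2) dl l := by
  have hok : SegOK [cell dN] dl := by rcases hdl with rfl | rfl <;> decide
  have hoffs : offs [cell dN] dl = [(0, 0)] := by rcases hdl with rfl | rfl <;> decide
  have hoff : off [cell dN] dl 1 = dl := by rcases hdl with rfl | rfl <;> decide
  have hneed : needs [cell dN] dl = [(0, 0)] := by rcases hdl with rfl | rfl <;> decide
  obtain ⟨α', h1, h2, -⟩ := hS.seg hC (b := false) (by omega) hi rfl
    (by simp [startLab]) (L := [cell dN]) rfl (dl := dl) hok (by rw [hl, hg]) rfl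
    (F := fun u v => u = 0 ∧ v = 0) (by simp [hneed])
    (by rintro u v ⟨rfl, rfl⟩; simpa using ⟨hr, hn⟩)
    (x' := 0 + dl.1) (y' := y + dl.2) (by simp [hoff]) (by simp [hoff]) hend
    (by intro u hu; cases hu) (by omega) (Q := fun u v => u = 0 ∧ v = 0) (by simp [hoffs])
    (S' := S') (by intro u v; rw [hS', sub_zero, sub_eq_zero])
  rw [hl] at h2
  exact ⟨α', h1, h2⟩

end Rows

/-- Global to local coordinates of strip `j`. -/
def Par.loc (P : Par) (j : ℕ) (p : Pos) : Pos :=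
  match j with
  | 0 => (p.1 - 1 + P.W, p.2)
  | 1 => (P.N - 1 - p.2, p.1 - 1 + P.W)
  | 2 => (P.N - P.W - p.1, P.N - 1 - p.2)
  | _ => (p.2, P.N - P.W - p.1)

theorem Par.emb_loc (P : Par) (j : ℕ) (p : Pos) : P.emb j (P.loc j p) = p := by
  match j with
  | 0 => ext <;> simp [Par.emb, Par.loc, rot, Par.corner]
  | 1 => ext <;> simp [Par.emb, Par.loc, rot, Par.corner]
  | 2 => ext <;> simp [Par.emb, Par.loc, rot, Par.corner]
  | n + 3 => ext <;> simp [Par.emb, Par.loc, rot, Par.corner]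

theorem Par.loc_emb (P : Par) (j : ℕ) (p : Pos) : P.loc j (P.emb j p) = p :=
  P.emb_injective j (P.emb_loc j _)

theorem Par.mem_image_emb (P : Par) (j : ℕ) (S : ℤ → ℤ → Prop) (p : Pos) :
    p ∈ P.emb j '' {q | S q.1 q.2} ↔ S (P.loc j p).1 (P.loc j p).2 := by
  constructor
  · rintro ⟨q, hq, rfl⟩
    rw [P.loc_emb]
    exact hq
  · intro h
    exact ⟨P.loc j p, h, P.emb_loc j p⟩

/-- Consistency of the parameters. -/
structure Par.Valid (P : Par) : Prop where
  le_w : 6 ≤ P.w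
  N_eq : (P.N : ℤ) = P.W + 6 * P.K + 1
  W_le : P.W + 6 ≤ 6 * P.K
  K_le : P.K ≤ 2 ^ P.w
  bits_eq : ∀ j m, P.bits j m = (2 ^ P.w - (if j < 3 then P.K else P.K - 1)).testBit m

/-- The domain of the first `j` strips. -/
def Par.strips (P : Par) : ℕ → Set Pos
  | 0 => ∅
  | j + 1 => P.strips j ∪ P.emb j '' {q | P.Flat (6 * P.K) q.1 q.2}

theorem Par.emb_turn (P : Par) {j : ℕ} (hj : j < 3) (hP : P.Valid) :
    P.emb j (0, 6 * P.K + 1) = P.emb (j + 1) (P.W - 1, 0) := by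
  have := hP.N_eq
  interval_cases j <;> ext <;> simp [Par.emb, rot, Par.corner] <;> omega

theorem rot_turn {j : ℕ} (hj : j < 3) : rot j dN = rot (j + 1) dW := by
  interval_cases j <;> rfl

theorem Par.strips_disjoint (P : Par) (hP : P.Valid) {j : ℕ} (hj : j < 4) {x y : ℤ}
    (hr : P.Rect x y) : P.emb j (x, y) ∉ P.strips j := by
  have h1 := hP.N_eq
  have h2 := hP.W_le
  unfold Par.Rect at hr
  interval_cases j <;>
    simp only [Par.strips, Set.mem_union, P.mem_image_emb, Set.mem_empty_iff_false, false_or] <;>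
    simp [Par.emb, Par.loc, rot, Par.corner, Par.Flat] <;> omega

theorem Par.strips_end (P : Par) (hP : P.Valid) {j : ℕ} (hj : j < 3) :
    P.emb j (0, 6 * P.K + 1) ∉ P.strips j := by
  have h1 := hP.N_eq
  have h2 := hP.W_le
  have h3 := P.W_eq
  interval_cases j <;>
    simp only [Par.strips, Set.mem_union, P.mem_image_emb, Set.mem_empty_iff_false, false_or] <;>
    simp [Par.emb, Par.loc, rot, Par.corner, Par.Flat] <;> omega

theorem Par.Valid.ctx {P : Par} (hP : P.Valid) {s : ℤ} {𝒯 : TAS} (h𝒯 : P.Sys s 𝒯) {j : ℕ}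
    (hj : j < 4) : P.Ctx s 𝒯 j (P.strips j) :=
  ⟨h𝒯, hj, fun _ _ => P.strips_disjoint hP hj⟩

theorem Par.Valid.bits_add {P : Par} (hP : P.Valid) (j : ℕ) :
    2 ^ P.w - (if j < 3 then P.K else P.K - 1) + (if j < 3 then P.K else P.K - 1) =
      2 ^ P.w := by
  have := hP.K_le
  split_ifs <;> omega

section Frame

variable {P : Par} {s : ℤ} {𝒯 : TAS}

/-- After `j ≤ 3` strips, strip `j` has been started. -/
theorem Par.Valid.run_strips (hP : P.Valid) (h𝒯 : P.Sys s 𝒯)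
    (hseed : 𝒯.seedTile = P.pathTile s 0 0 0 false false 0) {j : ℕ} (hj : j < 4) :
    ∃ α, Run 𝒯 𝒯.seed α ∧ P.St j (P.strips j) α (P.SI (P.w - 1))
      (4 * ((P.w - 1 : ℕ) : ℤ) + 3) 0 dW (j, 1, P.w - 1, false, false, 0) := by
  have h1 := hP.N_eq
  have h2 := hP.W_le
  have h3 := P.W_eq
  have h4 := hP.le_w
  induction j with
  | zero => exact Par.St.start_seed (hP.ctx h𝒯 (by omega)) hseed (by omega)
  | succ j ih =>
    obtain ⟨α, h5, h6⟩ := ih (by omega)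
    have hj3 : j < 3 := by omega
    have hb := hP.bits_add j
    have hbe := hP.bits_eq j
    rw [if_pos hj3] at hb hbe
    obtain ⟨α', h7, h8⟩ := h6.strip (hP.ctx h𝒯 (by omega)) (r := P.K) (by omega) hb (by omega)
      (by omega) hbe (l := (j + 1, 0, 0, false, false, 0)) (by simp [Par.nxt, hj3])
      (by rw [P.gdir_kind0, rot_turn hj3]) (P.strips_end hP hj3)
    have h9 : P.St (j + 1) (P.strips (j + 1)) α' (fun _ _ => False) (P.W - 1) 0 dW
        (j + 1, 0, 0, false, false, 0) := by
      refine ⟨?_, ?_⟩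
      · rw [h8.dom]
        simp [Par.strips]
      · rw [← P.emb_turn hj3 hP, ← rot_turn hj3]
        exact h8.tip
    obtain ⟨α'', h10, h11⟩ := h9.start (hP.ctx h𝒯 hj) (by omega) (by omega) (by omega)
    exact ⟨α'', h5.trans (h7.trans h10), h11⟩

/-- The fourth strip together with the first `n` cells of the tail. -/
def Par.Tailed (P : Par) (n : ℕ) (x y : ℤ) : Prop :=
  P.Flat (6 * P.K - 6) x y ∨ x = 0 ∧ 0 ≤ y ∧ y ≤ 6 * P.K - 6 + n

theorem Par.Valid.run_tail (hP : P.Valid) (h𝒯 : P.Sys s 𝒯)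
    (hseed : 𝒯.seedTile = P.pathTile s 0 0 0 false false 0) {n : ℕ} (hn : n < 6) :
    ∃ α, Run 𝒯 𝒯.seed α ∧ P.St 3 (P.strips 3) α (P.Tailed n) 0
      (6 * P.K - 6 + n + 1) dN (3, 5, 5 - n, false, false, 0) := by
  have h1 := hP.N_eq
  have h2 := hP.W_le
  have h3 := P.W_eq
  have h4 := hP.le_w
  have hC := hP.ctx h𝒯 (j := 3) (by omega)
  induction n with
  | zero =>
    obtain ⟨α, h5, h6⟩ := hP.run_strips h𝒯 hseed (j := 3) (by omega)
    have hb := hP.bits_add 3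
    have hbe := hP.bits_eq 3
    rw [if_neg (by omega)] at hb hbe
    have hc : 6 * ((P.K - 1 : ℕ) : ℤ) = 6 * P.K - 6 := by omega
    obtain ⟨α', h7, h8⟩ := h6.strip hC (r := P.K - 1) (by omega) hb
      (by omega) (by omega) hbe (l := (3, 5, 5, false, false, 0)) (by simp [Par.nxt])
      (by rw [P.gdir_kind5]) (P.strips_disjoint hP (by omega) (by unfold Par.Rect; omega))
    rw [hc] at h8
    refine ⟨α', h5.trans h7, ?_, ?_⟩
    · rw [h8.dom]
      congr 2
      ext p
      simp only [Set.mem_ofPred_eq, Par.Tailed, Par.Flat]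
      omega
    · have := h8.tip
      simpa using this
  | succ n ih =>
    obtain ⟨α, h5, h6⟩ := ih (by omega)
    have hy : 6 * (P.K : ℤ) - 6 + n + 1 = 6 * P.K - 6 + ((n + 1 : ℕ) : ℤ) := by push_cast; ring
    obtain ⟨α', h7, h8⟩ := h6.tail hC (S' := P.Tailed (n + 1)) (by omega)
      (by unfold Par.Rect; omega) (by unfold Par.Tailed Par.Flat; omega)
      (l := (3, 5, 5 - (n + 1), false, false, 0)) (by
        have : 5 - n ≠ 0 := by omega
        simp only [Par.nxt, if_neg this]
        rfl) (Or.inl rfl) (by rw [P.gdir_kind5])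
      (h6.free hC (by unfold Par.Rect; simp; omega) (by unfold Par.Tailed Par.Flat; simp; omega))
      (by unfold Par.Tailed Par.Flat; intros; omega)
    refine ⟨α', h5.trans h7, ?_⟩
    rw [← hy]
    simpa using h8

/-- The interior region left by the frame. -/
def Par.Inner (P : Par) (p : Pos) : Prop :=
  1 ≤ p.1 ∧ p.1 ≤ P.N - 2 * P.W ∧ P.W ≤ p.2 ∧ p.2 < P.N - P.W ∨
    1 ≤ p.1 ∧ p.1 ≤ 6 ∧ 1 ≤ p.2 ∧ p.2 < P.W

/-- The square that is assembled. -/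
def Par.Square (P : Par) (p : Pos) : Prop :=
  -P.W < p.1 ∧ p.1 ≤ P.N - P.W ∧ 0 ≤ p.2 ∧ p.2 < P.N

/-- The frame is assembled by forced steps. -/
theorem Par.Valid.run_frame (hP : P.Valid) (h𝒯 : P.Sys s 𝒯)
    (hseed : 𝒯.seedTile = P.pathTile s 0 0 0 false false 0) :
    ∃ α, Run 𝒯 𝒯.seed α ∧ Tip α (1, 1) dN (code vLab) ∧
      ∀ p, α p ≠ none ↔ P.Square p ∧ ¬ P.Inner p := by
  have h1 := hP.N_eq
  have h2 := hP.W_le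
  have h3 := P.W_eq
  have h4 := hP.le_w
  have hC := hP.ctx h𝒯 (j := 3) (by omega)
  obtain ⟨α, h5, h6⟩ := hP.run_tail h𝒯 hseed (n := 5) (by omega)
  obtain ⟨α', h7, h8⟩ := h6.tail hC (S' := P.Tailed 6) (by omega)
    (by unfold Par.Rect; omega) (by unfold Par.Tailed Par.Flat; omega)
    (l := vLab) rfl (dl := dE) (Or.inr rfl) rfl
    (h6.free hC (by unfold Par.Rect; simp; omega) (by unfold Par.Tailed Par.Flat; simp))
    (by unfold Par.Tailed Par.Flat; intros; omega)
  refine ⟨α', h5.trans h7, ?_, fun p => ?_⟩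
  · have h9 := h8.tip
    have : P.emb 3 (0 + dE.1, 6 * (P.K : ℤ) - 6 + ((5 : ℕ) : ℤ) + 1 + dE.2) = (1, 1) := by
      ext <;> simp [Par.emb, rot, Par.corner]; omega
    rw [this] at h9
    exact h9
  · have h9 : α' p ≠ none ↔ p ∈ adom α' := Iff.rfl
    rw [h9, h8.dom]
    simp only [Par.strips, Set.mem_union, P.mem_image_emb, Set.mem_empty_iff_false, false_or]
    simp only [Par.loc, Par.Flat, Par.Tailed, Par.Square, Par.Inner]
    omega

end Frame

theorem Par.flood_tile {P : Par} {s : ℤ} {𝒯 : TAS} (h𝒯 : P.Sys s 𝒯) {t : Tile}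
    (ht : t ∈ 𝒯.tiles) :
    (0 < t.str dS → t.col dS = code vLab → t = vTile s) ∧
      (0 < t.str dW → t.col dW = code hLab → t = hTile s) := by
  have hs := h𝒯.pos
  rw [h𝒯.tiles, P.mem_tileSet_image] at ht
  rcases ht with rfl | rfl | ⟨j, kind, i, c, b, k, -, hk, -, -, rfl⟩
  · refine ⟨fun _ _ => rfl, fun h => ?_⟩
    have := mkTile_pos hs h
    simp [dS, dN, dE, dW] at this
  · refine ⟨fun h => ?_, fun _ _ => rfl⟩
    have := mkTile_pos hs h
    simp [dS, dE, dW] at this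
  · refine ⟨fun h hc => ?_, fun h hc => ?_⟩ <;>
    · have := mkTile_pos hs h
      rw [← Par.pathTile, hc] at this
      unfold Par.glue at this
      split_ifs at this with h1 h2
      · have := congrArg (fun l : Label => l.2.1) (code_injective (Option.some.inj this))
        simp [Par.inLab, vLab, hLab] at this
        omega
      · rw [code_injective (Option.some.inj this)] at h2
        revert h2
        simp [Par.gdir, vLab, hLab, dS, dN, dE, dW]

theorem vTile_pos {s : ℤ} (hs : 1 ≤ s) {u : Pos} (h : 0 < (vTile s).str u) :
    u = dS ∨ u = dN ∨ u = dE ∧ (vTile s).col u = code hLab := by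
  have := mkTile_pos hs h
  rw [← vTile] at this
  split_ifs at this with h1 h2 h3
  · exact Or.inl h1
  · exact Or.inr (Or.inl h2)
  · exact Or.inr (Or.inr ⟨h3, (Option.some.inj this).symm⟩)

theorem hTile_pos {s : ℤ} (hs : 1 ≤ s) {u : Pos} (h : 0 < (hTile s).str u) :
    u = dW ∨ u = dE ∧ (hTile s).col u = code hLab := by
  have := mkTile_pos hs h
  rw [← hTile] at this
  split_ifs at this with h1 h2
  · exact Or.inl h1
  · exact Or.inr ⟨h2, (Option.some.inj this).symm⟩

theorem vTile_glue (s : ℤ) :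
    ((vTile s).str dS = 1 ∧ (vTile s).col dS = code vLab) ∧
    ((vTile s).str dN = 1 ∧ (vTile s).col dN = code vLab) ∧
    ((vTile s).str dE = 1 ∧ (vTile s).col dE = code hLab) := by
  refine ⟨mkTile_of_ne ?_ ?_, mkTile_of_ne ?_ ?_, mkTile_of_ne ?_ ?_⟩ <;> simp [dS, dN, dE]

theorem hTile_glue (s : ℤ) :
    ((hTile s).str dW = 1 ∧ (hTile s).col dW = code hLab) ∧
    ((hTile s).str dE = 1 ∧ (hTile s).col dE = code hLab) := by
  refine ⟨mkTile_of_ne ?_ ?_, mkTile_of_ne ?_ ?_⟩ <;> simp [dW, dE]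

/-- The position from which an inner position is filled. -/
def inputSide (p : Pos) : Pos := if p.1 = 1 then dS else dW

noncomputable def floodTile (s : ℤ) (p : Pos) : Tile := if p.1 = 1 then vTile s else hTile s

open Classical in
/-- The completed square, given the frame `α`. -/
noncomputable def Par.filled (P : Par) (s : ℤ) (α : Assembly) : Assembly := fun p =>
  if P.Inner p then some (floodTile s p) else α p

/-- Assemblies between the frame and the completed square. -/
structure Par.Flooding (P : Par) (s : ℤ) (α β : Assembly) : Prop where
  frame : Extends α β
  sub : Extends β (P.filled s α)
  closed : ∀ p, P.Inner p → β p ≠ none → β (p + inputSide p) ≠ none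

structure Par.Frame (P : Par) (α : Assembly) : Prop where
  tip : Tip α (1, 1) dN (code vLab)
  dom : ∀ p, α p ≠ none ↔ P.Square p ∧ ¬ P.Inner p

theorem Par.Inner.square {P : Par} (hP : P.Valid) {p : Pos} (h : P.Inner p) : P.Square p := by
  have h1 := hP.N_eq
  have h2 := hP.W_le
  have h3 := P.W_eq
  have h4 := hP.le_w
  unfold Par.Inner at h
  unfold Par.Square
  omega

/-- The tile at a position of a flooded assembly. -/
theorem Par.Flooding.cases {P : Par} {s : ℤ} {α β : Assembly}
    (h : P.Flooding s α β) {p : Pos} {t : Tile} (ht : β p = some t) :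
    ¬ P.Inner p ∧ α p = some t ∨ P.Inner p ∧ t = floodTile s p := by
  have h1 := h.sub p (by simp [ht])
  rw [ht] at h1
  unfold Par.filled at h1
  split_ifs at h1 with hi
  · exact Or.inr ⟨hi, (Option.some.inj h1).symm⟩
  · exact Or.inl ⟨hi, h1⟩

theorem Par.Flooding.inner_of_none {P : Par} {s : ℤ} {α β : Assembly} (hF : P.Frame α)
    (h : P.Flooding s α β) {p : Pos} (hp : β p = none) (hs : P.Square p) : P.Inner p := by
  by_contra hi
  have h1 := (hF.dom p).2 ⟨hs, hi⟩
  rw [h.frame p h1] at hp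
  exact h1 hp

theorem Par.Flooding.step {P : Par} {s : ℤ} {𝒯 : TAS} (hP : P.Valid) (h𝒯 : P.Sys s 𝒯)
    {α β : Assembly} (hF : P.Frame α) (h : P.Flooding s α β) {m : Pos} {t : Tile}
    (hm : CanPlace 𝒯 β m t) : P.Flooding s α (Function.update β m (some t)) := by
  have h1 := hP.N_eq
  have h2 := hP.W_le
  have h3 := P.W_eq
  have h4 := hP.le_w
  have hs := h𝒯.pos
  obtain ⟨ht, hm0, hb⟩ := hm
  rw [h𝒯.temp] at hb
  obtain ⟨u, hu, t', hq, hinter⟩ := exists_pos_of_bind hb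
  obtain ⟨hcol, hstr, hpos⟩ := pos_interaction hinter
  have hft := P.flood_tile h𝒯 ht
  have key : P.Inner m ∧ u = inputSide m ∧ t = floodTile s m := by
    rcases h.cases hq with ⟨hi, ha⟩ | ⟨hi, rfl⟩
    · have hαm : α m = none := by
        by_contra hne
        rw [h.frame m hne] at hm0
        exact hne hm0
      obtain ⟨rfl, rfl, hc⟩ := hF.tip.only m u t' hu hαm ha (by rw [← hstr]; exact hpos)
      refine ⟨?_, rfl, ?_⟩
      · unfold Par.Inner; simp; omega
      · exact hft.1 hpos (by rw [← hc, ← hcol]; rfl)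
    · have hcl := h.closed _ hi (by simp [hq])
      have hsq := hi.square hP
      have hmu : m = m + u + -u := by abel
      unfold floodTile at hcol hstr
      unfold inputSide at hcl
      split_ifs at hcol hstr hcl with he
      · rcases vTile_pos hs (hstr ▸ hpos) with hd | hd | ⟨hd, hd'⟩
        · rw [← hd, ← hmu] at hcl
          exact absurd hm0 hcl
        · have hd : u = dS := by rw [← neg_neg u, hd]; rfl
          subst hd
          have hmi : P.Inner m := by
            refine h.inner_of_none hF hm0 ?_
            unfold Par.Square
            unfold Par.Inner at hi
            simp at he hi
            omega
          have h11 : m.1 = 1 := by simpa using he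
          refine ⟨hmi, by simp [inputSide, h11], ?_⟩
          rw [floodTile, if_pos h11]
          exact hft.1 hpos (by rw [hcol]; exact (vTile_glue s).2.1.2)
        · have hu : u = dW := by rw [← neg_neg u, hd]; rfl
          subst hu
          have hmi : P.Inner m := by
            refine h.inner_of_none hF hm0 ?_
            unfold Par.Square
            unfold Par.Inner at hi
            simp at he hi
            omega
          have h11 : m.1 ≠ 1 := by simp at he; omega
          refine ⟨hmi, by simp [inputSide, h11], ?_⟩
          rw [floodTile, if_neg h11]
          exact hft.2 hpos (by rw [hcol, hd'])
      · rcases hTile_pos hs (hstr ▸ hpos) with hd | ⟨hd, hd'⟩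
        · rw [← hd, ← hmu] at hcl
          exact absurd hm0 hcl
        · have hu : u = dW := by rw [← neg_neg u, hd]; rfl
          subst hu
          have hmi : P.Inner m := by
            refine h.inner_of_none hF hm0 ?_
            unfold Par.Square
            unfold Par.Inner at hi
            simp at he hi
            omega
          have h11 : m.1 ≠ 1 := by
            unfold Par.Inner at hi
            simp at hi
            omega
          refine ⟨hmi, by simp [inputSide, h11], ?_⟩
          rw [floodTile, if_neg h11]
          exact hft.2 hpos (by rw [hcol, hd'])
  obtain ⟨hmi, hmu, rfl⟩ := key
  have hne : ∀ p, β p ≠ none → Function.update β m (some (floodTile s m)) p ≠ none := by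
    intro p hp
    rw [extends_update _ hm0 p hp]
    exact hp
  refine ⟨h.frame.trans (extends_update _ hm0), fun p hp => ?_, fun p hp hp' => ?_⟩
  · by_cases hpm : p = m
    · subst hpm
      simp [Par.filled, hmi]
    · rw [Function.update_of_ne hpm] at hp ⊢
      exact h.sub p hp
  · by_cases hpm : p = m
    · subst hpm
      exact hne _ (by rw [← hmu, hq]; simp)
    · rw [Function.update_of_ne hpm] at hp'
      exact hne _ (h.closed p hp hp')

theorem Par.Flooding.fill {P : Par} {s : ℤ} {𝒯 : TAS} (h𝒯 : P.Sys s 𝒯)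
    {α β : Assembly} (hF : P.Frame α) (h : P.Flooding s α β) (hst : Stuck 𝒯 β) {p : Pos}
    (hp : P.Inner p) (hp' : β (p + inputSide p) ≠ none) : β p ≠ none := by
  intro hn
  refine hst p (floodTile s p) ⟨?_, hn, ?_⟩
  · rw [h𝒯.tiles, P.mem_tileSet_image]
    unfold floodTile
    split_ifs
    · exact Or.inl rfl
    · exact Or.inr (Or.inl rfl)
  rw [h𝒯.temp]
  refine one_le_bind (d := inputSide p) (by unfold inputSide; split_ifs <;> decide) ?_
    fun u _ _ => ?_
  · obtain ⟨t', ht'⟩ := Option.ne_none_iff_exists'.1 hp'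
    suffices hg : t'.str (-inputSide p) = 1 ∧
        t'.col (-inputSide p) = (floodTile s p).col (inputSide p) ∧
        (floodTile s p).str (inputSide p) = 1 by
      simp [term, ht', interaction, hg.1, hg.2.1, hg.2.2]
    have hS : -dS = dN := rfl
    have hW : -dW = dE := rfl
    rcases h.cases ht' with ⟨hi, ha⟩ | ⟨hi, rfl⟩
    · have h11 : p = (1, 1) := by
        have h1 := P.W_eq
        revert hi
        unfold inputSide
        unfold Par.Inner at hp ⊢
        split_ifs with he
        · simp
          intros
          ext
          · simp [he]
          · simp; omega
        · simp
          intros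
          exfalso
          omega
      subst h11
      obtain ⟨t'', h5, h6, h7⟩ := hF.tip.tip
      have e : ((1, 1) : Pos) + inputSide (1, 1) = (1, 1) - dN := rfl
      rw [e, h5] at ha
      obtain rfl := Option.some.inj ha
      exact ⟨h6, h7, (vTile_glue s).1.1⟩
    · unfold inputSide floodTile
      by_cases he : p.1 = 1
      · simp only [he, if_true]
        have : (p + dS).1 = 1 := by simp [he]
        rw [if_pos this, hS, (vTile_glue s).2.1.1, (vTile_glue s).2.1.2, (vTile_glue s).1.1,
          (vTile_glue s).1.2]
        exact ⟨rfl, rfl, rfl⟩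
      · simp only [he, if_false]
        rw [hW, (hTile_glue s).1.1, (hTile_glue s).1.2]
        split_ifs
        · exact ⟨(vTile_glue s).2.2.1, (vTile_glue s).2.2.2, rfl⟩
        · exact ⟨(hTile_glue s).2.1, (hTile_glue s).2.2, rfl⟩
  · have h0 : 0 ≤ (floodTile s p).str u := by
      unfold floodTile
      split_ifs <;> exact mkTile_nonneg (by simp)
    unfold term
    rcases β (p + u) with _ | t'
    · simp
    · exact interaction_nonneg (Or.inl h0)

theorem Par.Flooding.eq_of_stuck {P : Par} {s : ℤ} {𝒯 : TAS} (hP : P.Valid) (h𝒯 : P.Sys s 𝒯)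
    {α β : Assembly} (hF : P.Frame α) (h : P.Flooding s α β) (hst : Stuck 𝒯 β) :
    β = P.filled s α := by
  have h1 := hP.N_eq
  have h2 := hP.W_le
  have h3 := P.W_eq
  have h4 := hP.le_w
  have hout : ∀ p, P.Square p → ¬ P.Inner p → β p ≠ none := by
    intro p h5 h6 h7
    exact h6 (h.inner_of_none hF h7 h5)
  have hin : ∀ n : ℕ, ∀ p, P.Inner p → p.1 + p.2 ≤ n → β p ≠ none := by
    intro n
    induction n with
    | zero =>
      intro p hp hn
      unfold Par.Inner at hp
      push_cast at hn
      omega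
    | succ n ih =>
      intro p hp hn
      refine h.fill h𝒯 hF hst hp ?_
      have hsq : P.Square (p + inputSide p) := by
        have := hp.square hP
        unfold inputSide
        unfold Par.Inner at hp
        unfold Par.Square at this ⊢
        split_ifs <;> simp <;> omega
      by_cases hi : P.Inner (p + inputSide p)
      · refine ih _ hi ?_
        push_cast at hn
        unfold inputSide
        split_ifs <;> simp <;> omega
      · exact hout _ hsq hi
  funext p
  by_cases hp : P.Inner p
  · exact (h.sub p (hin (p.1 + p.2).toNat p hp (Int.self_le_toNat _))).symm
  · rw [Par.filled, if_neg hp]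
    by_cases hsq : P.Square p
    · exact h.frame p ((hF.dom p).2 ⟨hsq, hp⟩)
    · have e : α p = none := by
        by_contra hne
        exact hsq ((hF.dom p).1 hne).1
      rw [e]
      by_contra hne
      have := h.sub p hne
      rw [Par.filled, if_neg hp, e] at this
      exact hne this.symm

theorem Par.Valid.terminal_iff {P : Par} {s : ℤ} {𝒯 : TAS} (hP : P.Valid) (h𝒯 : P.Sys s 𝒯)
    (hseed : 𝒯.seedTile = P.pathTile s 0 0 0 false false 0) :
    ∃ A, adom A = {p | P.Square p} ∧ ∀ β, Terminal 𝒯 β ↔ β = A := by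
  obtain ⟨α, hrun, htip, hdom⟩ := hP.run_frame h𝒯 hseed
  have hF : P.Frame α := ⟨htip, hdom⟩
  have hadom : adom (P.filled s α) = {p | P.Square p} := by
    ext p
    simp only [adom, Set.mem_ofPred_eq, Par.filled]
    split_ifs with hi
    · simpa using hi.square hP
    · rw [hdom]
      simp [hi]
  have hsub : Extends α (P.filled s α) := fun p hp => by
    rw [Par.filled, if_neg ((hdom p).1 hp).2]
  have hbase : P.Flooding s α α := ⟨Extends.refl α, hsub,
    fun p hp h => absurd hp ((hdom p).1 h).2⟩
  refine ⟨P.filled s α, hadom, terminal_iff_of_invariant 𝒯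
    (fun β => Run 𝒯 β α ∨ P.Flooding s α β) _ ?_ (Or.inl hrun) ?_ ?_ ?_⟩
  · rw [hadom]
    refine ((Set.finite_Icc (-P.W) (P.N - P.W)).prod (Set.finite_Icc (0 : ℤ) P.N)).subset ?_
    rintro p ⟨h1, h2, h3, h4⟩
    exact ⟨⟨h1.le, h2⟩, ⟨h3, h4.le⟩⟩
  · rintro β (h | h)
    · exact (extends_of_run h).trans hsub
    · exact h.sub
  · rintro β m t (h | h) hm
    · rcases h.cases_head with rfl | ⟨γ, h1, h2⟩
      · exact Or.inr (hbase.step hP h𝒯 hF hm)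
      · rw [h1.2 m t hm]
        exact Or.inl h2
    · exact Or.inr (h.step hP h𝒯 hF hm)
  · rintro β (h | h) hst
    · rcases h.cases_head with rfl | ⟨γ, ⟨⟨m, t, h1⟩, -⟩, h2⟩
      · exact hbase.eq_of_stuck hP h𝒯 hF hst
      · exact absurd h1 (hst m t)
    · exact h.eq_of_stuck hP h𝒯 hF hst

theorem directed_and_square {𝒯 : TAS} {A : Assembly} {N : ℕ} (v : Pos)
    (hA : adom A = (fun p => p + v) '' SN N) (h : ∀ β, Terminal 𝒯 β ↔ β = A) :
    DirectedTAS 𝒯 ∧ StrictlySelfAssembles 𝒯 (SN N) := by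
  refine ⟨⟨A, (h A).2 rfl, fun β hβ => (h β).1 hβ⟩, fun β hβ => ⟨v, ?_⟩⟩
  rw [(h β).1 hβ, hA]

theorem SN_finite (N : ℕ) : (SN N).Finite := by
  refine ((Set.finite_Icc (0 : ℤ) N).prod (Set.finite_Icc (0 : ℤ) N)).subset ?_
  rintro p ⟨h1, h2, h3, h4⟩
  exact ⟨⟨h1, h2.le⟩, ⟨h3, h4.le⟩⟩

open Classical in
/-- Every edge inside the square gets its own glue. -/
noncomputable def gridGlue (N : ℕ) (p u : Pos) : Option ℕ :=
  if p + u ∈ SN N then some (Encodable.encode (p + p + u)) else none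

/-- The tile at position `p` of a square in which all positions carry distinct tiles. -/
noncomputable def gridTile (s : ℤ) (N : ℕ) (p : Pos) : Tile :=
  mkTile s (gridGlue N p) (if p = (0, 0) then some dW else none)

noncomputable def gridSet (N : ℕ) : Finset Tile :=
  (Finset.range N ×ˢ Finset.range N).image fun x => gridTile 1 N (x.1, x.2)

theorem card_gridSet (N : ℕ) : (gridSet N).card ≤ N * N := by
  refine Finset.card_image_le.trans ?_
  simp

theorem mem_gridSet_image {N : ℕ} {s : ℤ} {t : Tile} :
    t ∈ (gridSet N).image (reStr s) ↔ ∃ p ∈ SN N, t = gridTile s N p := by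
  simp only [gridSet, Finset.image_image, Finset.mem_image, Finset.mem_product,
    Finset.mem_range, Prod.exists, Function.comp, gridTile, reStr_mkTile]
  constructor
  · rintro ⟨a, b, ⟨h1, h2⟩, rfl⟩
    exact ⟨a, b, ⟨by simp, by simpa using h1, by simp, by simpa using h2⟩, rfl⟩
  · rintro ⟨a, b, ⟨h1, h2, h3, h4⟩, rfl⟩
    simp only at h1 h2 h3 h4
    lift a to ℕ using h1
    lift b to ℕ using h3
    exact ⟨a, b, ⟨by exact_mod_cast h2, by exact_mod_cast h4⟩, rfl⟩

theorem gridTile_mem {N : ℕ} (hN : 0 < N) : gridTile 1 N (0, 0) ∈ gridSet N :=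
  Finset.mem_image.2 ⟨(0, 0), by simp [hN], rfl⟩

theorem glueRestricted_gridSet {N : ℕ} (hN : 0 < N) : GlueRestricted (gridSet N) := by
  refine glueRestricted_of_mkTile (fun t ht => ?_) ⟨_, gridTile_mem hN, _, dW, by decide, rfl⟩
  obtain ⟨x, -, rfl⟩ := Finset.mem_image.1 ht
  exact ⟨_, _, rfl⟩

theorem gridTile_pos {s : ℤ} (hs : 1 ≤ s) {N : ℕ} {p u : Pos}
    (h : 0 < (gridTile s N p).str u) :
    p + u ∈ SN N ∧ (gridTile s N p).col u = Encodable.encode (p + p + u) := by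
  have := mkTile_pos hs h
  rw [← gridTile] at this
  unfold gridGlue at this
  split_ifs at this with h1
  exact ⟨h1, (Option.some.inj this).symm⟩

theorem gridTile_glue {s : ℤ} {N : ℕ} {p u : Pos} (h0 : p ≠ (0, 0) ∨ u ≠ dW)
    (h : p + u ∈ SN N) :
    (gridTile s N p).str u = 1 ∧ (gridTile s N p).col u = Encodable.encode (p + p + u) := by
  refine mkTile_of_ne ?_ (if_pos h)
  rcases h0 with h0 | h0
  · simp [h0]
  · split_ifs
    · simpa using h0.symm
    · simp

open Classical in
noncomputable def gridAssembly (s : ℤ) (N : ℕ) : Assembly := fun p =>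
  if p ∈ SN N then some (gridTile s N p) else none

theorem adom_gridAssembly (s : ℤ) (N : ℕ) : adom (gridAssembly s N) = SN N := by
  ext p
  simp [adom, gridAssembly]

theorem eq_of_gridAssembly {s : ℤ} {N : ℕ} {α : Assembly} (h : Extends α (gridAssembly s N))
    {p : Pos} {t : Tile} (ht : α p = some t) : p ∈ SN N ∧ t = gridTile s N p := by
  have := h p (by simp [ht])
  rw [ht] at this
  unfold gridAssembly at this
  split_ifs at this with h1
  exact ⟨h1, (Option.some.inj this).symm⟩

theorem terminal_grid {s : ℤ} (hs : 1 ≤ s) {N : ℕ} (hN : 0 < N) {𝒯 : TAS}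
    (htiles : 𝒯.tiles = (gridSet N).image (reStr s)) (hτ : 𝒯.temp = 1)
    (hseed : 𝒯.seedTile = gridTile s N (0, 0)) (β : Assembly) :
    Terminal 𝒯 β ↔ β = gridAssembly s N := by
  refine terminal_iff_of_invariant 𝒯
    (fun β => Extends β (gridAssembly s N) ∧ β (0, 0) ≠ none) _ ?_ ?_ ?_ ?_ ?_ β
  · rw [adom_gridAssembly]
    exact SN_finite N
  · refine ⟨fun p hp => ?_, by simp [TAS.seed]⟩
    unfold TAS.seed at hp ⊢
    split_ifs at hp ⊢ with h
    · subst h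
      rw [gridAssembly, if_pos (by simp [SN, hN]), hseed]
    · simp at hp
  · exact fun α h => h.1
  · rintro α m t ⟨h1, h2⟩ ⟨ht, hm, hb⟩
    refine ⟨fun p hp => ?_, by rwa [extends_update t hm _ h2]⟩
    by_cases hpm : p = m
    · subst hpm
      rw [hτ] at hb
      obtain ⟨u, -, t', hq, hinter⟩ := exists_pos_of_bind hb
      obtain ⟨hcol, hstr, hpos⟩ := pos_interaction hinter
      rw [htiles, mem_gridSet_image] at ht
      obtain ⟨q, hqm, rfl⟩ := ht
      obtain ⟨-, rfl⟩ := eq_of_gridAssembly h1 hq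
      have h3 := gridTile_pos hs hpos
      have h4 := gridTile_pos hs (hstr ▸ hpos)
      rw [h3.2, h4.2] at hcol
      have h5 := Encodable.encode_injective hcol
      have : q = p := by
        have h6 := congrArg Prod.fst h5
        have h7 := congrArg Prod.snd h5
        simp at h6 h7
        ext <;> omega
      subst this
      rw [gridAssembly, if_pos hqm, Function.update_self]
    · rw [Function.update_of_ne hpm] at hp ⊢
      exact h1 p hp
  · rintro α ⟨h1, h2⟩ hst
    have hfill : ∀ p u, p ∈ SN N → p ≠ (0, 0) → u ∈ U2 → p + u ∈ SN N →
        (p + u ≠ (0, 0) ∨ -u ≠ dW) → α (p + u) ≠ none → α p ≠ none := by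
      intro p u hp hp0 hu hpu hu0 hne hn
      refine hst p (gridTile s N p) ⟨?_, hn, ?_⟩
      · rw [htiles, mem_gridSet_image]
        exact ⟨p, hp, rfl⟩
      · rw [hτ]
        obtain ⟨t', ht'⟩ := Option.ne_none_iff_exists'.1 hne
        refine one_le_bind hu ?_ fun v _ _ => ?_
        · obtain ⟨-, rfl⟩ := eq_of_gridAssembly h1 ht'
          have h3 := gridTile_glue (s := s) (N := N) (Or.inl hp0) hpu
          have h4 := gridTile_glue (s := s) (N := N) (p := p + u) (u := -u) hu0
            (by simpa using hp)
          have e : p + u + (p + u) + -u = p + p + u := by abel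
          simp [term, ht', interaction, h3.1, h3.2, h4.1, h4.2, e]
        · unfold term
          rcases α (p + v) with _ | t''
          · simp
          · exact interaction_nonneg (Or.inl (mkTile_nonneg (by simp [hp0])))
    have hall : ∀ n : ℕ, ∀ p ∈ SN N, p.1 + p.2 ≤ n → α p ≠ none := by
      intro n
      induction n with
      | zero =>
        rintro p ⟨h3, h4, h5, h6⟩ hn
        have : p = (0, 0) := by
          push_cast at hn
          ext <;> simp <;> omega
        rwa [this]
      | succ n ih =>
        rintro p ⟨h3, h4, h5, h6⟩ hn
        push_cast at hn
        by_cases hp : p = (0, 0)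
        · rwa [hp]
        by_cases hx : p.1 = 0
        · have : p.2 ≠ 0 := fun hy => hp (by ext <;> assumption)
          have hm : p + dS ∈ SN N := by simp [SN]; omega
          exact hfill p dS ⟨h3, h4, h5, h6⟩ hp (by decide) hm (Or.inr (by decide))
            (ih _ hm (by simp; omega))
        · have hm : p + dW ∈ SN N := by simp [SN]; omega
          exact hfill p dW ⟨h3, h4, h5, h6⟩ hp (by decide) hm (Or.inr (by decide))
            (ih _ hm (by simp; omega))
    funext p
    by_cases hp : p ∈ SN N
    · exact (h1 p (hall (p.1 + p.2).toNat p hp (Int.self_le_toNat _))).symm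
    · rw [gridAssembly, if_neg hp]
      by_contra hne
      obtain ⟨t, ht⟩ := Option.ne_none_iff_exists'.1 hne
      exact hp (eq_of_gridAssembly h1 ht).1

theorem exists_grid_system {N : ℕ} (hN : 0 < N) {s : ℤ} (hs : 1 ≤ s) :
    ∃ 𝒯 : TAS, 𝒯.tiles = (gridSet N).image (reStr s) ∧
      𝒯.seedTile = reStr s (gridTile 1 N (0, 0)) ∧
      𝒯.temp = 1 ∧ DirectedTAS 𝒯 ∧ StrictlySelfAssembles 𝒯 (SN N) :=
  ⟨⟨_, _, 1, Finset.mem_image_of_mem _ (gridTile_mem hN)⟩, rfl, rfl, rfl,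
    directed_and_square 0 (by rw [adom_gridAssembly]; simp)
      (terminal_grid hs hN rfl rfl (reStr_mkTile _ _))⟩

theorem Par.seed_mem (P : Par) (hw : 0 < P.w) : P.pathTile 1 0 0 0 false false 0 ∈ P.tileSet := by
  simp only [Par.tileSet, Finset.mem_insert, Finset.mem_image]
  exact Or.inr (Or.inr ⟨(0, 0, 0, false, false, 0), by simp [hw], rfl⟩)

theorem Par.Valid.exists_system {P : Par} (hP : P.Valid) {s : ℤ} (hs : 1 ≤ s) :
    ∃ 𝒯 : TAS, 𝒯.tiles = P.tileSet.image (reStr s) ∧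
      𝒯.seedTile = reStr s (P.pathTile 1 0 0 0 false false 0) ∧
      𝒯.temp = 1 ∧ DirectedTAS 𝒯 ∧ StrictlySelfAssembles 𝒯 (SN P.N) := by
  have hw : 0 < P.w := by have := hP.le_w; omega
  let 𝒯 : TAS := ⟨_, _, 1, Finset.mem_image_of_mem (reStr s) (P.seed_mem hw)⟩
  obtain ⟨A, hA, h⟩ := hP.terminal_iff (𝒯 := 𝒯) ⟨hs, rfl, rfl⟩ (reStr_mkTile _ _)
  refine ⟨𝒯, rfl, rfl, rfl, directed_and_square (1 - P.W, 0) ?_ h⟩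
  rw [hA]
  ext p
  simp only [Set.mem_image, Set.mem_ofPred_eq, Par.Square, SN]
  constructor
  · rintro ⟨h1, h2, h3, h4⟩
    exact ⟨p - (1 - P.W, 0), ⟨by simp; omega, by simp; omega, by simp; omega, by simp; omega⟩,
      by simp⟩
  · rintro ⟨q, ⟨h1, h2, h3, h4⟩, rfl⟩
    simp
    omega

theorem eight_mul_add_le_two_pow {n : ℕ} (hn : 7 ≤ n) : 8 * n + 29 ≤ 2 ^ n := by
  induction n, hn using Nat.le_induction with
  | base => norm_num
  | succ n hn ih => rw [pow_succ]; omega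

theorem exists_valid {N : ℕ} (hN : 128 ≤ N) :
    ∃ P : Par, P.Valid ∧ P.N = N ∧ P.w ≤ Nat.log 2 N + 2 := by
  have hlog : 7 ≤ Nat.log 2 N := Nat.le_log_of_pow_le (by norm_num) (by omega)
  have h1 := eight_mul_add_le_two_pow hlog
  have h2 : 2 ^ Nat.log 2 N ≤ N := Nat.pow_log_le_self 2 (by omega)
  have h3 : N < 2 ^ (Nat.log 2 N + 1) := Nat.lt_pow_succ_log_self (by norm_num) N
  rw [pow_succ] at h3
  generalize Nat.log 2 N = n at *
  obtain ⟨wide, e, he, hpar⟩ : ∃ (wide : Bool) (e : ℕ), e = (if wide then 3 else 2) ∧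
      (N + e) % 2 = 1 := by
    rcases Nat.mod_two_eq_zero_or_one N with h | h
    · exact ⟨true, 3, rfl, by omega⟩
    · exact ⟨false, 2, rfl, by omega⟩
  have he3 : e ≤ 3 := by rw [he]; split_ifs <;> omega
  obtain ⟨w, K, h4, h5, h6⟩ : ∃ w K, n ≤ w ∧ w ≤ n + 2 ∧ N = 4 * w + e + 6 * K + 1 := by
    have : ∃ r ≤ 2, (N - 4 * (n + r) - e - 1) % 6 = 0 := by
      have : ((N - 4 * n - e - 1) % 6 = 0 ∨ (N - 4 * (n + 1) - e - 1) % 6 = 0) ∨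
          (N - 4 * (n + 2) - e - 1) % 6 = 0 := by omega
      rcases this with (h | h) | h
      · exact ⟨0, by omega, h⟩
      · exact ⟨1, by omega, h⟩
      · exact ⟨2, by omega, h⟩
    obtain ⟨r, hr, hr'⟩ := this
    exact ⟨n + r, (N - 4 * (n + r) - e - 1) / 6, by omega, by omega, by omega⟩
  have hpow : 2 ^ n ≤ 2 ^ w := Nat.pow_le_pow_right (by norm_num) h4
  have hWe : (Par.W ⟨w, wide, N, K,
      fun j m => (2 ^ w - (if j < 3 then K else K - 1)).testBit m⟩) = 4 * (w : ℤ) + e := by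
    simp only [Par.W, he]
    cases wide <;> simp
  refine ⟨⟨w, wide, N, K, fun j m => (2 ^ w - (if j < 3 then K else K - 1)).testBit m⟩,
    ⟨by simp only; omega, ?_, ?_, by simp only; omega, fun _ _ => rfl⟩, rfl, h5⟩
  · rw [hWe]
    simp only
    omega
  · rw [hWe]
    simp only
    omega

theorem one_le_logb {N : ℕ} (hN : 2 ≤ N) : 1 ≤ Real.logb 2 N := by
  rw [Real.le_logb_iff_rpow_le (by norm_num) (by positivity), Real.rpow_one]
  exact_mod_cast hN

end TA

open TA Real in
/-- There is a constant `C > 0` such that for every `N ≥ 2` there is a tile set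
`T` of at most `C · log₂ N` tile types, with all glue strengths in `{-1,0,1}` and
a unique negative glue color, such that for every integer `s ≥ 1` the temperature-1
system obtained by giving the unique negative glue strength `-s` (via `reStr s`)
is directed and strictly self-assembles the `N × N` square. -/
theorem prgTAS_square_log :
    ∃ C : ℝ, 0 < C ∧ ∀ N : ℕ, 2 ≤ N →
      ∃ (T : Finset Tile) (seed : Tile), seed ∈ T ∧ GlueRestricted T ∧
        (T.card : ℝ) ≤ C * logb 2 N ∧
        ∀ s : ℤ, 1 ≤ s →
          ∃ 𝒯 : TAS, 𝒯.tiles = T.image (reStr s) ∧ 𝒯.seedTile = reStr s seed ∧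
            𝒯.temp = 1 ∧ DirectedTAS 𝒯 ∧ StrictlySelfAssembles 𝒯 (SN N) := by
  refine ⟨16384, by norm_num, fun N hN => ?_⟩
  have hlog := one_le_logb hN
  rcases lt_or_ge N 128 with h | h
  · refine ⟨gridSet N, gridTile 1 N (0, 0), gridTile_mem (by omega),
      glueRestricted_gridSet (by omega), ?_, fun s hs => exists_grid_system (by omega) hs⟩
    have h1 : (gridSet N).card ≤ 16384 := (card_gridSet N).trans (by nlinarith)
    have h2 : ((gridSet N).card : ℝ) ≤ 16384 := by exact_mod_cast h1
    linarith
  · obtain ⟨P, hP, rfl, hw⟩ := exists_valid h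
    have hw0 : 0 < P.w := by have := hP.le_w; omega
    refine ⟨P.tileSet, _, P.seed_mem hw0, P.glueRestricted hw0, ?_,
      fun s hs => hP.exists_system hs⟩
    have h1 : P.tileSet.card ≤ 2304 * (Nat.log 2 P.N + 2) + 2 := P.card_tileSet.trans (by omega)
    have h2 : (P.tileSet.card : ℝ) ≤ 2304 * ((Nat.log 2 P.N : ℝ) + 2) + 2 := by exact_mod_cast h1
    have h3 : (Nat.log 2 P.N : ℝ) ≤ logb 2 P.N := by exact_mod_cast Real.natLog_le_logb P.N 2
    linarith
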